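/- Let (X,d) be a compact metric space, f: X → X a topologically mixing homeomorphism with the exponential shadowing property, and A: X → GL(m,ℝ) a Hölder continuous matrix function. Suppose μ_1 and μ_2 are ergodic f-invariant measures with χ_max(A,μ_1) > χ_max(A,μ_2), and set h* = min{h_{μ_1}(f), h_{μ_2}(f)}, H* = max{h_{μ_1}(f), h_{μ_2}(f)}. Then min{ h_top(f, MLI(A,f)), h^P_top(f, MLI(A,f)) } ≥ H* and h^B_top(f, MLI(A,f)) ≥ h*. -/

import Mathlib

open Filter MeasureTheory Set Topology Manifold
open scoped ENNReal NNReal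

section EntropyDefs

variable {X : Type*} [MetricSpace X]

/-- The open dynamical (Bowen) ball `B_n(x,r) = {y | d_n(x,y) < r}`. -/
def dynBall (f : X → X) (x : X) (n : ℕ) (r : ℝ) : Set X :=
  {y | ∀ i < n, dist (f^[i] x) (f^[i] y) < r}

/-- The closed dynamical (Bowen) ball `{y | d_n(x,y) ≤ r}`. -/
def dynCBall (f : X → X) (x : X) (n : ℕ) (r : ℝ) : Set X :=
  {y | ∀ i < n, dist (f^[i] x) (f^[i] y) ≤ r}

/-- `S` is an `(n,ε)`-separated subset of `E`. -/
def IsDynSep (f : X → X) (E : Set X) (n : ℕ) (ε : ℝ) (S : Set X) : Prop :=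
  S ⊆ E ∧ ∀ x ∈ S, ∀ y ∈ S, x ≠ y → ∃ i < n, ε < dist (f^[i] x) (f^[i] y)

/-- The maximal cardinality `s_n(E,ε)` of an `(n,ε)`-separated subset of `E`. -/
noncomputable def sepCount (f : X → X) (E : Set X) (n : ℕ) (ε : ℝ) : ℕ :=
  sSup {k | ∃ S : Finset X, IsDynSep f E n ε ↑S ∧ S.card = k}

/-- Bowen's separated-set topological entropy of a compact set:
`lim_{ε→0} limsup_n (1/n) log s_n(E,ε)`. -/
noncomputable def compactEnt (f : X → X) (E : Set X) : EReal :=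
  ⨆ (ε : ℝ) (_ : 0 < ε),
    Filter.limsup (fun n : ℕ => ((Real.log (sepCount f E n ε) / n : ℝ) : EReal)) Filter.atTop

/-- Topological entropy of an arbitrary subset `Y`: the supremum over compact `E ⊆ Y`. -/
noncomputable def topEnt (f : X → X) (Y : Set X) : EReal :=
  ⨆ (E : Set X) (_ : IsCompact E) (_ : E ⊆ Y), compactEnt f E

/-- The sum `Σ e^{-t·u}` over a family of Bowen balls recorded as center/order pairs. -/
noncomputable def bowenSum (t : ℝ) (s : Set (X × ℕ)) : ℝ≥0∞ :=
  ∑' p : s, ENNReal.ofReal (Real.exp (-t * ((p : X × ℕ).2 : ℝ)))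

/-- `C(E;t,n,σ,f)`: infimum of `Σ e^{-t·u}` over countable covers of `E` by Bowen
balls `B_u(x,σ)` with `u ≥ n`. -/
noncomputable def bowenCn (f : X → X) (E : Set X) (t : ℝ) (σ : ℝ) (n : ℕ) : ℝ≥0∞ :=
  ⨅ (s : Set (X × ℕ)) (_ : s.Countable) (_ : ∀ p ∈ s, n ≤ p.2)
    (_ : E ⊆ ⋃ p ∈ s, dynBall f p.1 p.2 σ), bowenSum t s

/-- `C(E;t,σ,f) = lim_{n→∞} C(E;t,n,σ,f)` (the limit of the nondecreasing sequence). -/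
noncomputable def bowenC (f : X → X) (E : Set X) (t : ℝ) (σ : ℝ) : ℝ≥0∞ :=
  ⨆ n : ℕ, bowenCn f E t σ n

/-- Bowen–Hausdorff entropy at scale `σ`: `inf {t | C(E;t,σ,f) = 0}`. -/
noncomputable def bowenEntAt (f : X → X) (E : Set X) (σ : ℝ) : EReal :=
  sInf {t : EReal | ∃ t' : ℝ, t = (t' : EReal) ∧ bowenC f E t' σ = 0}

/-- Bowen–Hausdorff entropy `h^B_top(f,E) = lim_{σ→0} h^B_top(E;σ,f)`. -/
noncomputable def bowenEnt (f : X → X) (E : Set X) : EReal :=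
  ⨆ (σ : ℝ) (_ : 0 < σ), bowenEntAt f E σ

/-- Feng–Huang packing pre-measure `P^s_{N,ε}(E)`: supremum of `Σ e^{-s·n_i}` over countable
pairwise disjoint families of closed Bowen balls of orders `n_i ≥ N` centered in `E`. -/
noncomputable def packPre (f : X → X) (s : ℝ) (N : ℕ) (ε : ℝ) (E : Set X) : ℝ≥0∞ :=
  ⨆ (D : Set (X × ℕ)) (_ : D.Countable) (_ : ∀ p ∈ D, p.1 ∈ E ∧ N ≤ p.2)
    (_ : D.Pairwise fun p q => Disjoint (dynCBall f p.1 p.2 ε) (dynCBall f q.1 q.2 ε)),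
    ∑' p : D, ENNReal.ofReal (Real.exp (-s * ((p : X × ℕ).2 : ℝ)))

/-- `P^s_ε(E) = lim_{N→∞} P^s_{N,ε}(E)` (the limit of the nonincreasing sequence). -/
noncomputable def packPreLim (f : X → X) (s ε : ℝ) (E : Set X) : ℝ≥0∞ :=
  ⨅ N : ℕ, packPre f s N ε E

/-- Feng–Huang packing measure `𝒫^s_ε(E) = inf {Σ_i P^s_ε(E_i) | E ⊆ ⋃ E_i}`. -/
noncomputable def packMeas (f : X → X) (s ε : ℝ) (E : Set X) : ℝ≥0∞ :=
  ⨅ (C : ℕ → Set X) (_ : E ⊆ ⋃ i, C i), ∑' i, packPreLim f s ε (C i)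

/-- Packing topological entropy at scale `ε`: the critical exponent of `s ↦ 𝒫^s_ε(E)`. -/
noncomputable def packEntAt (f : X → X) (E : Set X) (ε : ℝ) : EReal :=
  sInf {t : EReal | ∃ t' : ℝ, t = (t' : EReal) ∧ packMeas f t' ε E = 0}

/-- Packing topological entropy `h^P_top(f,E) = lim_{ε→0} h^P_top(f,E,ε)`. -/
noncomputable def packEnt (f : X → X) (E : Set X) : EReal :=
  ⨆ (ε : ℝ) (_ : 0 < ε), packEntAt f E ε

/-- The restriction of `f` to `Λ` is topologically mixing. -/
def TopMixingOn (f : X → X) (Λ : Set X) : Prop :=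
  ∀ U V : Set X, IsOpen U → IsOpen V → (U ∩ Λ).Nonempty → (V ∩ Λ).Nonempty →
    ∃ N : ℕ, ∀ n ≥ N, (f^[n] '' (U ∩ Λ) ∩ (V ∩ Λ)).Nonempty

end EntropyDefs

section MetricEntropy

variable {X : Type*} [MeasurableSpace X]

/-- Entropy `H_μ(⋁_{i=0}^{n-1} f^{-i} ξ)` of the `n`-th dynamical refinement of the finite
measurable partition `ξ = {P⁻¹(c)}_{c}`. -/
noncomputable def partHn (f : X → X) (μ : MeasureTheory.Measure X) {k : ℕ}
    (P : X → Fin k) (n : ℕ) : ℝ :=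
  ∑ c : Fin n → Fin k,
    Real.negMulLog (μ {x | ∀ i : Fin n, P (f^[(i : ℕ)] x) = c i}).toReal

/-- Kolmogorov–Sinai metric entropy `h_μ(f)`: the supremum over finite measurable partitions of
`lim_n (1/n) H_μ(⋁_{i<n} f^{-i} ξ) = inf_{n ≥ 1} (1/n) H_μ(⋁_{i<n} f^{-i} ξ)`. -/
noncomputable def ksEnt (f : X → X) (μ : MeasureTheory.Measure X) : EReal :=
  ⨆ (k : ℕ) (P : X → Fin k) (_ : Measurable P),
    (((⨅ n : ℕ, partHn f μ P (n + 1) / ((n : ℝ) + 1)) : ℝ) : EReal)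

end MetricEntropy

section CocycleDefs

/-- Euclidean space `ℝ^m`. -/
abbrev Em (m : ℕ) := EuclideanSpace ℝ (Fin m)

variable {X : Type*} {m : ℕ}

/-- The cocycle generated by the `GL(m,ℝ)`-valued function `A` over `f`:
`A(x,n) = A(f^{n-1}x) ⋯ A(f x) A(x)`. -/
noncomputable def cocycle (f : X → X) (A : X → (Em m ≃L[ℝ] Em m)) (x : X) :
    ℕ → (Em m →L[ℝ] Em m)
  | 0 => ContinuousLinearMap.id ℝ (Em m)
  | n + 1 => ((A (f^[n] x) : Em m →L[ℝ] Em m)).comp (cocycle f A x n)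

/-- `A` is an `α`-Hölder continuous matrix function for some exponent `α > 0`
(in the operator norm). -/
def HolderMat [MetricSpace X] (A : X → (Em m ≃L[ℝ] Em m)) : Prop :=
  ∃ α C : ℝ, 0 < α ∧ 0 ≤ C ∧ ∀ x y : X,
    ‖((A x : Em m →L[ℝ] Em m)) - ((A y : Em m →L[ℝ] Em m))‖ ≤ C * dist x y ^ α

/-- The set `MLI(A,f)` of Max-Lyapunov-irregular points: points where
`lim_n (1/n) log ‖A(x,n)‖` does not exist. -/
def MLIrr (f : X → X) (A : X → (Em m ≃L[ℝ] Em m)) : Set X :=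
  {x | ¬ ∃ c : ℝ,
    Filter.Tendsto (fun n : ℕ => Real.log ‖cocycle f A x n‖ / n) Filter.atTop (nhds c)}

/-- The maximal Lyapunov exponent of an invariant measure:
`χ_max(A,μ) = lim_n (1/n) ∫ log ‖A(x,n)‖ dμ = inf_{n ≥ 1} (1/n) ∫ log ‖A(x,n)‖ dμ`. -/
noncomputable def mle [MeasurableSpace X] (f : X → X) (A : X → (Em m ≃L[ℝ] Em m))
    (μ : MeasureTheory.Measure X) : ℝ :=
  ⨅ n : ℕ, (∫ x, Real.log ‖cocycle f A x (n + 1)‖ ∂μ) / ((n : ℝ) + 1)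

/-- `μ` is a Lyapunov-minimizing (ergodic) measure for the cocycle `A`:
`χ_max(A,μ) = inf {χ_max(A,ν) : ν an f-invariant Borel probability measure}`. -/
def IsLyapMin [MeasurableSpace X] (f : X → X) (A : X → (Em m ≃L[ℝ] Em m))
    (μ : MeasureTheory.Measure X) : Prop :=
  mle f A μ = sInf {r : ℝ | ∃ ν : MeasureTheory.Measure X,
    MeasureTheory.IsProbabilityMeasure ν ∧ MeasureTheory.MeasurePreserving f ν ν ∧
    r = mle f A ν}

end CocycleDefs

section ShadowingDefs

variable {X : Type*} [MetricSpace X]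

/-- The cumulative times `c_i` associated with a sequence of block lengths `(n_i)_{i∈ℤ}`. -/
def csum (nseq : ℤ → ℕ) (i : ℤ) : ℤ :=
  if 0 ≤ i then ∑ j ∈ Finset.range i.toNat, (nseq j : ℤ)
  else -∑ j ∈ Finset.range (-i).toNat, (nseq (i + j) : ℤ)

/-- `{x_i, n_i}_{i∈ℤ}` is a `δ`-pseudo-orbit for `f`: `d(f^{n_i}(x_i), x_{i+1}) < δ`. -/
def IsPseudoOrbit (f : X → X) (δ : ℝ) (x : ℤ → X) (nseq : ℤ → ℕ) : Prop :=
  (∀ i, 1 ≤ nseq i) ∧ ∀ i : ℤ, dist (f^[nseq i] (x i)) (x (i + 1)) < δ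

/-- `p` is a `(τ,λ)`-shadowing point for the pseudo-orbit `{x_i, n_i}`:
`d(f^{c_i+j}(p), f^j(x_i)) < τ e^{-λ min{j, n_i - j}}` for `0 ≤ j ≤ n_i - 1`, `i ∈ ℤ`. -/
def IsExpShadowed (f : X ≃ X) (τ lam : ℝ) (x : ℤ → X) (nseq : ℤ → ℕ) (p : X) : Prop :=
  ∀ i : ℤ, ∀ j < nseq i,
    dist ((f ^ (csum nseq i + (j : ℤ)) : X ≃ X) p) ((⇑f)^[j] (x i))
      < τ * Real.exp (-lam * ((min j (nseq i - j) : ℕ) : ℝ))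

/-- The `λ`-exponential shadowing property. -/
def ExpShadowingWith (f : X ≃ X) (lam : ℝ) : Prop :=
  ∀ τ > (0 : ℝ), ∃ δ > (0 : ℝ), ∀ (x : ℤ → X) (nseq : ℤ → ℕ),
    IsPseudoOrbit (⇑f) δ x nseq → ∃ p : X, IsExpShadowed f τ lam x nseq p

/-- The exponential shadowing property: `λ`-exponential shadowing for some `λ > 0`. -/
def ExpShadowing (f : X ≃ X) : Prop := ∃ lam > (0 : ℝ), ExpShadowingWith f lam

end ShadowingDefs

/-- **Mean ergodic theorem in measure**: the Birkhoff averages of a square integrable function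
converge in measure to its space average. -/
theorem Ergodic.tendstoInMeasure_birkhoffAverage {X : Type*} [MeasurableSpace X] {μ : Measure X}
    [IsProbabilityMeasure μ] {f : X → X} (hf : Ergodic f μ) {φ : X → ℝ} (hφ : MemLp φ 2 μ) :
    TendstoInMeasure μ (fun n => birkhoffAverage ℝ f φ n) atTop (fun _ => ∫ x, φ x ∂μ) := by
  have hmp := hf.toMeasurePreserving
  let T := (Lp.compMeasurePreservingₗᵢ ℝ (E := ℝ) (p := 2) f hmp).toContinuousLinearMap
  have hT : ‖T‖ ≤ 1 := LinearIsometry.norm_toContinuousLinearMap_le _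
  have hlim := T.tendsto_birkhoffAverage_orthogonalProjection hT (hφ.toLp φ)
  set V := T.eqLocus (1 : Lp ℝ 2 μ →L[ℝ] Lp ℝ 2 μ)
  set y : Lp ℝ 2 μ := ((V.orthogonalProjectionOnto (hφ.toLp φ) : V) : Lp ℝ 2 μ)
  have hyV : T y = y := (V.orthogonalProjectionOnto (hφ.toLp φ)).2
  have hyc : (y : X → ℝ) ∘ f =ᵐ[μ] y := by
    have h1 : T y =ᵐ[μ] (y : X → ℝ) ∘ f := Lp.coeFn_compMeasurePreserving y hmp
    rw [hyV] at h1
    exact h1.symm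
  obtain ⟨c, hc⟩ := hf.ae_eq_const_of_ae_eq_comp_ae (Lp.aestronglyMeasurable y) hyc
  have h1m : MemLp (fun _ : X => (1 : ℝ)) 2 μ := memLp_const 1
  have h1V : h1m.toLp _ ∈ V := by
    change T (h1m.toLp _) = h1m.toLp _
    exact Lp.toLp_compMeasurePreserving h1m hmp
  have horth : inner ℝ (hφ.toLp φ - y) (h1m.toLp _) = 0 := by
    have := V.sub_starProjection_mem_orthogonal (hφ.toLp φ)
    rw [Submodule.mem_orthogonal'] at this
    exact this _ h1V
  have hcφ : c = ∫ x, φ x ∂μ := by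
    rw [inner_sub_left, sub_eq_zero, L2.inner_def, L2.inner_def] at horth
    have e1 : ∫ a, inner ℝ ((hφ.toLp φ : X → ℝ) a) ((h1m.toLp _ : X → ℝ) a) ∂μ
        = ∫ x, φ x ∂μ := by
      refine integral_congr_ae ?_
      filter_upwards [hφ.coeFn_toLp, h1m.coeFn_toLp] with x hx hx'
      rw [hx, hx']; simp
    have e2 : ∫ a, inner ℝ ((y : X → ℝ) a) ((h1m.toLp _ : X → ℝ) a) ∂μ = c := by
      rw [integral_congr_ae (g := fun _ => c)]
      · simp
      · filter_upwards [hc, h1m.coeFn_toLp] with x hx hx'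
        rw [hx, hx']; simp
    rw [e1, e2] at horth
    exact horth.symm
  have havg : ∀ n, (birkhoffAverage ℝ T _root_.id n (hφ.toLp φ) : Lp ℝ 2 μ) =ᵐ[μ]
      birkhoffAverage ℝ f φ n := by
    intro n
    have hit : ∀ k, (T^[k] (hφ.toLp φ) : Lp ℝ 2 μ) =ᵐ[μ] fun x => φ (f^[k] x) := by
      intro k
      have e : T^[k] (hφ.toLp φ) = Lp.compMeasurePreserving f^[k] (hmp.iterate k) (hφ.toLp φ) := by
        rw [← Lp.compMeasurePreserving_iterate]; rfl
      rw [e, Lp.toLp_compMeasurePreserving]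
      exact MemLp.coeFn_toLp _
    have hsum : ∀ n, (birkhoffSum T _root_.id n (hφ.toLp φ) : Lp ℝ 2 μ) =ᵐ[μ]
        birkhoffSum f φ n := by
      intro n
      induction n with
      | zero => simpa using AEEqFun.coeFn_zero
      | succ n ih =>
        rw [birkhoffSum_succ]
        filter_upwards [ih, hit n, Lp.coeFn_add (birkhoffSum T _root_.id n (hφ.toLp φ))
          (_root_.id (T^[n] (hφ.toLp φ)))] with x h1 h2 h3
        rw [h3, birkhoffSum_succ, Pi.add_apply, h1, id, h2]
    filter_upwards [hsum n, Lp.coeFn_smul ((n : ℝ)⁻¹) (birkhoffSum T _root_.id n (hφ.toLp φ))]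
      with x h1 h2
    rw [birkhoffAverage, h2, Pi.smul_apply, h1]
    rfl
  have := tendstoInMeasure_of_tendsto_Lp hlim
  refine (this.congr_left havg).congr_right ?_
  filter_upwards [hc] with x hx
  rw [← hcφ]; exact hx

section TileCoding

/-- The probability of reading the letter `b` where the letter `a` is expected, when letters are
replaced by uniformly random ones with probability `κ`. -/
noncomputable def letterWeight {k : ℕ} (κ : ℝ) (a b : Fin k) : ℝ :=
  (if a = b then 1 - κ else 0) + κ / k

/-- The probability that a word of length `N` is produced by the following random source: first the
pending letters are emitted, then repeatedly either a uniformly random letter is emitted, or a tile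
`W i` is selected with (sub-)probability `p i` and emitted; letters of tiles are transmitted with
noise `κ`. -/
noncomputable def tileWeight {k : ℕ} {ι : Type*} (F : Finset ι) (p : ι → ℝ)
    (W : ι → List (Fin k)) (κ : ℝ) : (N : ℕ) → List (Fin k) → (Fin N → Fin k) → ℝ
  | 0, _, _ => 1
  | N + 1, a :: st, w => letterWeight κ a (w 0) * tileWeight F p W κ N st (Fin.tail w)
  | N + 1, [], w => 1 / (2 * k) * tileWeight F p W κ N [] (Fin.tail w) +
      1 / 2 * ∑ i ∈ F, p i * match W i with
        | [] => 0
        | a :: st => letterWeight κ a (w 0) * tileWeight F p W κ N st (Fin.tail w)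

variable {k : ℕ} {ι : Type*} {F : Finset ι} {p : ι → ℝ} {W : ι → List (Fin k)} {κ : ℝ}

theorem letterWeight_nonneg (hκ : 0 ≤ κ) (hκ' : κ ≤ 1) (a b : Fin k) : 0 ≤ letterWeight κ a b := by
  unfold letterWeight
  split_ifs <;> [skip; rw [zero_add]] <;> [(have := sub_nonneg.2 hκ'); skip] <;> positivity

theorem sum_letterWeight (a : Fin k) : ∑ b, letterWeight κ a b = 1 := by
  have hk : (k : ℝ) ≠ 0 := by
    have := a.pos
    positivity
  simp [letterWeight, Finset.sum_add_distrib, mul_div_cancel₀ κ hk]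

theorem tileWeight_nonneg (hp : ∀ i ∈ F, 0 ≤ p i) (hκ : 0 ≤ κ) (hκ' : κ ≤ 1) :
    ∀ (N : ℕ) (st : List (Fin k)) (w : Fin N → Fin k), 0 ≤ tileWeight F p W κ N st w := by
  intro N
  induction N with
  | zero => intro st w; simp [tileWeight]
  | succ N ih =>
    intro st w
    cases st with
    | cons a st =>
      rw [tileWeight]
      exact mul_nonneg (letterWeight_nonneg hκ hκ' _ _) (ih _ _)
    | nil =>
      rw [tileWeight]
      refine add_nonneg (mul_nonneg (by positivity) (ih _ _)) (mul_nonneg (by norm_num) ?_)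
      refine Finset.sum_nonneg fun i hi => mul_nonneg (hp i hi) ?_
      split
      · exact le_rfl
      · exact mul_nonneg (letterWeight_nonneg hκ hκ' _ _) (ih _ _)

theorem sum_words_succ {N : ℕ} (g : Fin k → (Fin N → Fin k) → ℝ) :
    ∑ w : Fin (N + 1) → Fin k, g (w 0) (Fin.tail w) = ∑ b, ∑ w, g b w := by
  rw [← Fintype.sum_prod_type']
  exact Fintype.sum_equiv (Fin.consEquiv fun _ => Fin k).symm _ _ fun w => rfl

theorem sum_tileWeight_le_one (hp : ∀ i ∈ F, 0 ≤ p i) (hp1 : ∑ i ∈ F, p i ≤ 1) :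
    ∀ (N : ℕ) (st : List (Fin k)), ∑ w, tileWeight F p W κ N st w ≤ 1 := by
  intro N
  induction N with
  | zero => intro st; simp [tileWeight]
  | succ N ih =>
    have hcons : ∀ (a : Fin k) (st : List (Fin k)), ∑ w : Fin (N + 1) → Fin k,
        letterWeight κ a (w 0) * tileWeight F p W κ N st (Fin.tail w) ≤ 1 := by
      intro a st
      rw [sum_words_succ fun b w => letterWeight κ a b * tileWeight F p W κ N st w]
      simp_rw [← Finset.mul_sum]
      rw [← Finset.sum_mul, sum_letterWeight, one_mul]
      exact ih st
    intro st
    cases st with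
    | cons a st =>
      simp_rw [tileWeight]
      exact hcons a st
    | nil =>
      simp_rw [tileWeight]
      rw [Finset.sum_add_distrib, ← Finset.mul_sum, ← Finset.mul_sum, Finset.sum_comm]
      have h1 : 1 / (2 * (k : ℝ)) * ∑ w : Fin (N + 1) → Fin k,
          tileWeight F p W κ N [] (Fin.tail w) ≤ 1 / 2 := by
        rw [sum_words_succ fun _ w => tileWeight F p W κ N [] w]
        rw [Finset.sum_const, Finset.card_univ, Fintype.card_fin, nsmul_eq_mul]
        rcases Nat.eq_zero_or_pos k with rfl | hk
        · norm_num
        · have hk' : (0 : ℝ) < k := by exact_mod_cast hk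
          have := ih []
          calc 1 / (2 * (k : ℝ)) * (k * ∑ w, tileWeight F p W κ N [] w)
              = 1 / 2 * ∑ w, tileWeight F p W κ N [] w := by field_simp
            _ ≤ 1 / 2 := by linarith
      have h2 : ∑ i ∈ F, ∑ w : Fin (N + 1) → Fin k, (p i * match W i with
          | [] => 0
          | a :: st => letterWeight κ a (w 0) * tileWeight F p W κ N st (Fin.tail w)) ≤ 1 := by
        refine le_trans (Finset.sum_le_sum fun i hi => ?_) hp1
        rw [← Finset.mul_sum]
        refine mul_le_of_le_one_right (hp i hi) ?_
        cases W i with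
        | nil => simp
        | cons a st => exact hcons a st
      linarith

/-- The list `st` agrees with the `P`-name of `x` at the times when the orbit visits `K`. -/
def NameAgrees {X : Type*} (f : X → X) (P : X → Fin k) (K : Set X) (x : X)
    (st : List (Fin k)) : Prop :=
  ∀ (j : ℕ) (h : j < st.length), f^[j] x ∈ K → P (f^[j] x) = st[j]

theorem NameAgrees.tail {X : Type*} {f : X → X} {P : X → Fin k} {K : Set X} {x : X} {a : Fin k}
    {st : List (Fin k)} (h : NameAgrees f P K x (a :: st)) : NameAgrees f P K (f x) st :=
  fun j hj hK => h (j + 1) (by simpa using hj) hK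

/-- The cost per letter of the coding by tiles. -/
noncomputable def tileCost {X : Type*} (k : ℕ) (K G : Set X) (θ κ : ℝ) (x : X) : ℝ :=
  θ - Real.log (1 - κ) + Kᶜ.indicator (fun _ => Real.log (k / κ)) x +
    Gᶜ.indicator (fun _ => Real.log (2 * k)) x

/-- Every orbit segment has a code whose length is controlled by `tileCost`. -/
theorem exp_le_tileWeight {X : Type*} {f : X → X} {P : X → Fin k} {K G : Set X} {s θ U : ℝ}
    (hκ : 0 < κ) (hκ' : κ < 1) (hθ : 0 ≤ θ) (hU : 0 ≤ U)
    (hp : ∀ i ∈ F, p i = Real.exp (-s * (W i).length))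
    (hW : ∀ i ∈ F, W i ≠ []) (hWθ : ∀ i ∈ F, Real.log 2 + s * (W i).length ≤ (W i).length * θ)
    (hWU : ∀ i ∈ F, (W i).length * θ ≤ U)
    (hG : ∀ x ∈ G, ∃ i ∈ F, NameAgrees f P K x (W i)) :
    ∀ (N : ℕ) (st : List (Fin k)) (x : X), NameAgrees f P K x st → st.length * θ ≤ U →
      Real.exp (-(birkhoffSum f (tileCost k K G θ κ) N x) + st.length * θ - U)
        ≤ tileWeight F p W κ N st (fun i => P (f^[(i : ℕ)] x)) := by
  have hp0 : ∀ i ∈ F, 0 ≤ p i := fun i hi => by rw [hp i hi]; positivity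
  intro N
  induction N with
  | zero =>
    intro st x _ hst
    rw [tileWeight, Real.exp_le_one_iff, birkhoffSum_zero]
    linarith
  | succ N ih =>
    intro st x hst hstU
    have hk : (1 : ℝ) ≤ k := by exact_mod_cast (P x).pos
    have hlogκ : Real.log (1 - κ) ≤ 0 := Real.log_nonpos (by linarith) (by linarith)
    have hkκ : 0 ≤ Real.log (k / κ) := Real.log_nonneg (by rw [le_div_iff₀ hκ]; linarith)
    have h2k : 0 ≤ Real.log (2 * k) := Real.log_nonneg (by linarith)
    have hiK : 0 ≤ Kᶜ.indicator (fun _ => Real.log (k / κ)) x := indicator_nonneg (fun _ _ => hkκ) x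
    have hiG : 0 ≤ Gᶜ.indicator (fun _ => Real.log (2 * k)) x := indicator_nonneg (fun _ _ => h2k) x
    have htail : Fin.tail (fun i : Fin (N + 1) => P (f^[(i : ℕ)] x)) =
        fun i : Fin N => P (f^[(i : ℕ)] (f x)) := by
      funext i
      simp [Fin.tail]
    have hcons : ∀ (a : Fin k) (st : List (Fin k)), NameAgrees f P K x (a :: st) →
        (a :: st).length * θ ≤ U →
        Real.exp (-(birkhoffSum f (tileCost k K G θ κ) (N + 1) x) + (a :: st).length * θ - U)
          ≤ letterWeight κ a (P x) *
            tileWeight F p W κ N st (fun i => P (f^[(i : ℕ)] (f x))) := by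
      intro a st hst hstU
      have hlen : ((a :: st).length : ℝ) = st.length + 1 := by simp
      have h1 := ih st (f x) hst.tail (by rw [hlen] at hstU; nlinarith)
      have h2 : Real.exp (-(tileCost k K G θ κ x) + θ) ≤ letterWeight κ a (P x) := by
        by_cases hxK : x ∈ K
        · have hPa : P x = a := hst 0 (by simp) hxK
          calc Real.exp (-(tileCost k K G θ κ x) + θ) ≤ Real.exp (Real.log (1 - κ)) := by
                rw [Real.exp_le_exp]; unfold tileCost; linarith
            _ = 1 - κ := Real.exp_log (by linarith)
            _ ≤ letterWeight κ a (P x) := by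
                simp only [letterWeight, hPa, if_true]
                have : 0 ≤ κ / k := by positivity
                linarith
        · have hi : Kᶜ.indicator (fun _ => Real.log (k / κ)) x = Real.log (k / κ) :=
            indicator_of_mem hxK _
          calc Real.exp (-(tileCost k K G θ κ x) + θ) ≤ Real.exp (-Real.log (k / κ)) := by
                rw [Real.exp_le_exp]; unfold tileCost; linarith
            _ = κ / k := by
                rw [← Real.log_inv, inv_div]; exact Real.exp_log (by positivity)
            _ ≤ letterWeight κ a (P x) := by
                unfold letterWeight
                split_ifs <;> linarith
      calc _ = Real.exp (-(tileCost k K G θ κ x) + θ) *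
            Real.exp (-(birkhoffSum f (tileCost k K G θ κ) N (f x)) + st.length * θ - U) := by
            rw [← Real.exp_add, birkhoffSum_succ', hlen]; congr 1; ring
        _ ≤ _ := mul_le_mul h2 h1 (Real.exp_nonneg _) ((Real.exp_nonneg _).trans h2)
    cases st with
    | cons a st =>
      rw [tileWeight, htail]
      exact hcons a st hst hstU
    | nil =>
      rw [tileWeight, htail]
      have hs0 : ∀ i ∈ F, 0 ≤ p i * match W i with
          | [] => 0
          | a :: st => letterWeight κ a (P (f^[((0 : Fin (N + 1)) : ℕ)] x)) *
              tileWeight F p W κ N st (fun i => P (f^[(i : ℕ)] (f x))) := by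
        intro i hi
        refine mul_nonneg (hp0 i hi) ?_
        split
        · exact le_rfl
        · exact mul_nonneg (letterWeight_nonneg hκ.le hκ'.le _ _)
            (tileWeight_nonneg hp0 hκ.le hκ'.le _ _ _)
      by_cases hxG : x ∈ G
      · obtain ⟨i, hi, hag⟩ := hG x hxG
        refine le_trans ?_ (le_add_of_nonneg_left (mul_nonneg (by positivity)
          (tileWeight_nonneg hp0 hκ.le hκ'.le _ _ _)))
        refine le_trans ?_ (mul_le_mul_of_nonneg_left
          (Finset.single_le_sum hs0 hi) (by norm_num))
        have hWi := hW i hi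
        have hlen := hWθ i hi
        have hlenU := hWU i hi
        rw [hp i hi]
        generalize hWi' : W i = l at *
        cases l with
        | nil => exact absurd rfl hWi
        | cons a st =>
          have := hcons a st hag hlenU
          simp only [Fin.val_zero, Function.iterate_zero, _root_.id] at this ⊢
          refine le_trans ?_ (mul_le_mul_of_nonneg_left (mul_le_mul_of_nonneg_left this
            (Real.exp_nonneg _)) (by norm_num))
          have e : (1 : ℝ) / 2 = Real.exp (-Real.log 2) := by
            rw [Real.exp_neg, Real.exp_log (by norm_num)]; norm_num
          rw [e, ← Real.exp_add, ← Real.exp_add, Real.exp_le_exp]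
          simp only [List.length_nil, Nat.cast_zero, zero_mul]
          linarith
      · refine le_trans ?_ (le_add_of_nonneg_right (mul_nonneg (by norm_num)
          (Finset.sum_nonneg hs0)))
        have h1 := ih [] (f x) (fun j hj => by simp at hj) (by simpa using hU)
        refine le_trans ?_ (mul_le_mul_of_nonneg_left h1 (by positivity))
        have e : 1 / (2 * (k : ℝ)) = Real.exp (-Real.log (2 * k)) := by
          rw [Real.exp_neg, Real.exp_log (by positivity), one_div]
        have hi : Gᶜ.indicator (fun _ => Real.log (2 * k)) x = Real.log (2 * k) :=
          indicator_of_mem hxG _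
        rw [e, ← Real.exp_add, Real.exp_le_exp, birkhoffSum_succ']
        have : Real.log (2 * k) ≤ tileCost k K G θ κ x := by
          unfold tileCost; linarith
        simp only [List.length_nil, Nat.cast_zero, zero_mul]
        linarith

end TileCoding

/-- **Gibbs inequality** for the names of orbit segments: the entropy of the `n`-th refinement of a
partition is at most the mean length of any code. -/
theorem partHn_le_integral {X : Type*} [MeasurableSpace X] {μ : Measure X}
    [IsProbabilityMeasure μ] {f : X → X} (hf : Measurable f) {k : ℕ} {P : X → Fin k}
    (hP : Measurable P) {N : ℕ} {q : (Fin N → Fin k) → ℝ} (hq : ∀ w, 0 ≤ q w)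
    (hq1 : ∑ w, q w ≤ 1) {g : X → ℝ} (hg : Integrable g μ)
    (hgq : ∀ x, Real.exp (-g x) ≤ q (fun i => P (f^[(i : ℕ)] x))) :
    partHn f μ P N ≤ ∫ x, g x ∂μ := by
  set name : X → Fin N → Fin k := fun x i => P (f^[(i : ℕ)] x) with hname
  have hmeas : Measurable name :=
    measurable_pi_lambda _ fun i => hP.comp (hf.iterate i)
  have hset : ∀ c : Fin N → Fin k,
      (μ {x | ∀ i : Fin N, P (f^[(i : ℕ)] x) = c i}).toReal = (μ.map name).real {c} := by
    intro c
    rw [measureReal_def, Measure.map_apply hmeas (measurableSet_singleton c)]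
    congr 2
    ext x
    simp [hname, funext_iff]
  have hprob : IsProbabilityMeasure (μ.map name) :=
    Measure.isProbabilityMeasure_map hmeas.aemeasurable
  have hp1 : ∑ c, (μ.map name).real {c} = 1 := by
    simp
  have hterm : ∀ c, Real.negMulLog ((μ.map name).real {c}) ≤
      (μ.map name).real {c} * (-Real.log (q c)) + q c - (μ.map name).real {c} := by
    intro c
    rcases (measureReal_nonneg (μ := μ.map name) (s := {c})).eq_or_lt with h0 | hpos
    · rw [← h0]; simp [hq c]
    · have hne : (name ⁻¹' {c}).Nonempty := by
        by_contra hemp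
        rw [not_nonempty_iff_eq_empty] at hemp
        rw [measureReal_def, Measure.map_apply hmeas (measurableSet_singleton c), hemp] at hpos
        simp at hpos
      obtain ⟨x, rfl⟩ := hne
      have hqpos : 0 < q (name x) := (Real.exp_pos _).trans_le (hgq x)
      have h := Real.log_le_sub_one_of_pos (div_pos hqpos hpos)
      rw [Real.log_div hqpos.ne' hpos.ne'] at h
      have h' := mul_le_mul_of_nonneg_left h hpos.le
      rw [mul_sub, mul_sub, mul_one, mul_div_cancel₀ _ hpos.ne'] at h'
      rw [Real.negMulLog]
      linarith
  have hlog_int : ∑ c, (μ.map name).real {c} * (-Real.log (q c)) =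
      ∫ x, -Real.log (q (name x)) ∂μ := by
    have e := integral_map hmeas.aemeasurable (μ := μ)
      (f := fun c => -Real.log (q c)) (Measurable.of_discrete).aestronglyMeasurable
    rw [← e, integral_fintype (Integrable.of_finite)]
    simp
  calc partHn f μ P N = ∑ c, Real.negMulLog ((μ.map name).real {c}) := by
        unfold partHn
        exact Finset.sum_congr rfl fun c _ => by rw [hset c]
    _ ≤ ∑ c, ((μ.map name).real {c} * (-Real.log (q c)) + q c - (μ.map name).real {c}) :=
        Finset.sum_le_sum fun c _ => hterm c
    _ ≤ ∫ x, -Real.log (q (name x)) ∂μ := by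
        rw [Finset.sum_sub_distrib, Finset.sum_add_distrib, hlog_int, hp1]
        linarith
    _ ≤ ∫ x, g x ∂μ := by
        refine integral_mono ?_ hg fun x => ?_
        · exact (Integrable.of_finite (μ := μ.map name)
            (f := fun c => -Real.log (q c))).comp_measurable hmeas
        · have := Real.log_le_log (Real.exp_pos _) (hgq x)
          rw [Real.log_exp] at this
          simp only
          linarith

theorem partHn_nonneg {X : Type*} [MeasurableSpace X] {μ : Measure X}
    [IsProbabilityMeasure μ] {f : X → X} {k : ℕ} {P : X → Fin k} (N : ℕ) :
    0 ≤ partHn f μ P N :=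
  Finset.sum_nonneg fun _ _ => Real.negMulLog_nonneg ENNReal.toReal_nonneg
    (ENNReal.toReal_le_of_le_ofReal zero_le_one (by simpa using prob_le_one))

theorem integral_birkhoffSum {X : Type*} [MeasurableSpace X] {μ : Measure X} {f : X → X}
    (hf : MeasurePreserving f μ μ) {g : X → ℝ} (hg : Integrable g μ) (N : ℕ) :
    Integrable (birkhoffSum f g N) μ ∧ ∫ x, birkhoffSum f g N x ∂μ = N * ∫ x, g x ∂μ := by
  have hi : ∀ j, Integrable (fun x => g (f^[j] x)) μ := fun j =>
    (hf.iterate j).integrable_comp_of_integrable hg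
  have he : ∀ j, ∫ x, g (f^[j] x) ∂μ = ∫ x, g x ∂μ := fun j => by
    have := hf.iterate j
    rw [← integral_map this.aemeasurable (by rw [this.map_eq]; exact hg.aestronglyMeasurable),
      this.map_eq]
  constructor
  · exact integrable_finsetSum _ fun j _ => hi j
  · simp only [birkhoffSum]
    rw [integral_finsetSum _ fun j _ => hi j]
    simp [he]

theorem partHn_le_of_tiles {X : Type*} [MeasurableSpace X] {μ : Measure X}
    [IsProbabilityMeasure μ] {f : X → X} (hf : MeasurePreserving f μ μ) {k : ℕ} {P : X → Fin k}
    (hP : Measurable P) {K G : Set X} (hK : MeasurableSet K) (hGm : MeasurableSet G)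
    {ι : Type*} {F : Finset ι} {W : ι → List (Fin k)} {s θ U κ : ℝ}
    (hκ : 0 < κ) (hκ' : κ < 1) (hθ : 0 ≤ θ) (hU : 0 ≤ U)
    (hF : ∑ i ∈ F, Real.exp (-s * (W i).length) ≤ 1)
    (hW : ∀ i ∈ F, W i ≠ []) (hWθ : ∀ i ∈ F, Real.log 2 + s * (W i).length ≤ (W i).length * θ)
    (hWU : ∀ i ∈ F, (W i).length * θ ≤ U)
    (hG : ∀ x ∈ G, ∃ i ∈ F, NameAgrees f P K x (W i)) (N : ℕ) :
    partHn f μ P N ≤ N * (θ - Real.log (1 - κ) + μ.real Kᶜ * Real.log (k / κ) +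
      μ.real Gᶜ * Real.log (2 * k)) + U := by
  have hKi : Integrable (Kᶜ.indicator (fun _ => Real.log (k / κ))) μ :=
    (integrable_const _).indicator hK.compl
  have hGi : Integrable (Gᶜ.indicator (fun _ => Real.log (2 * k))) μ :=
    (integrable_const _).indicator hGm.compl
  have hci : Integrable (tileCost k K G θ κ) μ :=
    ((integrable_const (θ - Real.log (1 - κ))).add hKi).add hGi
  have hce : ∫ x, tileCost k K G θ κ x ∂μ = θ - Real.log (1 - κ) +
      μ.real Kᶜ * Real.log (k / κ) + μ.real Gᶜ * Real.log (2 * k) := by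
    unfold tileCost
    have hadd := (integrable_const (μ := μ) (θ - Real.log (1 - κ))).add hKi
    simp only [Pi.add_def] at hadd
    rw [integral_add hadd hGi,
      integral_add (integrable_const (θ - Real.log (1 - κ))) hKi,
      integral_indicator_const _ hK.compl, integral_indicator_const _ hGm.compl]
    simp
  obtain ⟨hbi, hbe⟩ := integral_birkhoffSum hf hci N
  have hpos : ∀ i ∈ F, 0 ≤ Real.exp (-s * (W i).length) := fun i _ => (Real.exp_pos _).le
  have key := partHn_le_integral hf.measurable hP (N := N)
    (q := tileWeight F (fun i => Real.exp (-s * (W i).length)) W κ N [])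
    (tileWeight_nonneg hpos hκ.le hκ'.le N [])
    (sum_tileWeight_le_one hpos hF N []) (g := fun x => birkhoffSum f (tileCost k K G θ κ) N x + U)
    (hbi.add (integrable_const U)) (fun x => by
      have := exp_le_tileWeight (p := fun i => Real.exp (-s * (W i).length)) hκ hκ' hθ hU
        (fun i _ => rfl) hW hWθ hWU hG N [] x (fun j hj => by simp at hj) (by simpa using hU)
      convert! this using 2
      simp; ring)
  rw [integral_add hbi (integrable_const U), hbe, hce] at key
  simpa using key

/-- A finite measurable partition of a compact metric space agrees with a locally constant function
on a compact set of almost full measure. -/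
theorem exists_closed_partition_approx {X : Type*} [MetricSpace X] [CompactSpace X]
    [MeasurableSpace X] [BorelSpace X] (μ : Measure X) [IsProbabilityMeasure μ] {k : ℕ}
    {P : X → Fin k} (hP : Measurable P) {δ : ℝ} (hδ : 0 < δ) :
    ∃ K : Set X, IsClosed K ∧ μ.real Kᶜ ≤ δ ∧
      ∃ ε > 0, ∀ x ∈ K, ∀ y ∈ K, dist x y < ε → P x = P y := by
  have hPc : ∀ c, MeasurableSet (P ⁻¹' {c}) := fun c => hP (measurableSet_singleton c)
  have hk : 0 < (k : ℝ) + 1 := by positivity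
  choose C hCs hCc hCm using fun c => (hPc c).exists_isClosed_sdiff_lt (μ := μ)
    (measure_ne_top _ _) (ε := ENNReal.ofReal (δ / (k + 1)))
    (by simpa using div_pos hδ hk)
  refine ⟨⋃ c, C c, isClosed_iUnion_of_finite hCc, ?_, ?_⟩
  · have hsub : (⋃ c, C c)ᶜ ⊆ ⋃ c, (P ⁻¹' {c} \ C c) := by
      intro x hx
      rw [mem_compl_iff, mem_iUnion, not_exists] at hx
      exact mem_iUnion.2 ⟨P x, rfl, hx _⟩
    calc μ.real (⋃ c, C c)ᶜ ≤ μ.real (⋃ c, (P ⁻¹' {c} \ C c)) := measureReal_mono hsub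
      _ ≤ ∑ c, μ.real (P ⁻¹' {c} \ C c) := measureReal_iUnion_fintype_le _
      _ ≤ ∑ _c : Fin k, δ / (k + 1) := by
          refine Finset.sum_le_sum fun c _ => ?_
          exact ENNReal.toReal_le_of_le_ofReal (by positivity) (hCm c).le
      _ ≤ δ := by
          rw [Finset.sum_const, Finset.card_univ, Fintype.card_fin, nsmul_eq_mul,
            mul_div_assoc', div_le_iff₀ hk]
          nlinarith
  · set Z : Set (X × X) := ⋃ c, ⋃ c', if c = c' then ∅ else C c ×ˢ C c' with hZ
    have hZc : IsCompact Z := by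
      refine (isClosed_iUnion_of_finite fun c => isClosed_iUnion_of_finite fun c' => ?_).isCompact
      split_ifs
      · exact isClosed_empty
      · exact (hCc c).prod (hCc c')
    obtain ⟨ε, hε, h⟩ := hZc.exists_forall_le' (f := fun z => dist z.1 z.2) (a := 0)
      (by fun_prop) (by
        rintro ⟨x, y⟩ hz
        simp only [hZ, mem_iUnion] at hz
        obtain ⟨c, c', hz⟩ := hz
        split_ifs at hz with hcc
        · exact hz.elim
        · refine dist_pos.2 fun hxy => hcc ?_
          have h1 : P x = c := hCs c hz.1
          have h2 : P y = c' := hCs c' hz.2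
          rw [← h1, ← h2]; exact congrArg P hxy)
    refine ⟨ε, hε, fun x hx y hy hxy => ?_⟩
    obtain ⟨c, hc⟩ := mem_iUnion.1 hx
    obtain ⟨c', hc'⟩ := mem_iUnion.1 hy
    have h1 : P x = c := hCs c hc
    have h2 : P y = c' := hCs c' hc'
    rw [h1, h2]
    by_contra hcc
    refine absurd (h (x, y) ?_) (not_le.2 hxy)
    simp only [hZ, mem_iUnion]
    exact ⟨c, c', by rw [if_neg hcc]; exact ⟨hc, hc'⟩⟩

/-- Covers of a set of large measure by Bowen balls of arbitrary orders have large `s`-weight when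
`s` is smaller than the metric entropy. -/
theorem exists_le_sum_of_cover {X : Type*} [MetricSpace X] [CompactSpace X]
    [MeasurableSpace X] [BorelSpace X] {μ : Measure X} [IsProbabilityMeasure μ] {f : X → X}
    (hf : MeasurePreserving f μ μ) {s : ℝ} (hs : (s : EReal) < ksEnt f μ) :
    ∃ ε > 0, ∃ δ > 0, ∃ c > 0, ∀ G : Set X, MeasurableSet G → μ.real Gᶜ ≤ δ →
      ∀ {ι : Type*} (F : Finset ι) (y : ι → X) (u : ι → ℕ),
        G ⊆ ⋃ i ∈ F, dynBall f (y i) (u i) ε → c ≤ ∑ i ∈ F, Real.exp (-s * u i) := by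
  rcases lt_or_ge s 0 with hs0 | hs0
  · refine ⟨1, one_pos, 1 / 2, by norm_num, 1, one_pos, fun G hGm hG ι F y u hcov => ?_⟩
    have hne : G.Nonempty := by
      by_contra h
      rw [not_nonempty_iff_eq_empty] at h
      rw [h, compl_empty, probReal_univ] at hG
      norm_num at hG
    obtain ⟨x, hx⟩ := hne
    obtain ⟨i, hi, -⟩ := mem_iUnion₂.1 (hcov hx)
    refine le_trans ?_ (Finset.single_le_sum (fun j _ => (Real.exp_pos _).le) hi)
    refine Real.one_le_exp ?_
    have : (0 : ℝ) ≤ u i := by positivity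
    nlinarith
  unfold ksEnt at hs
  simp only [lt_iSup_iff] at hs
  obtain ⟨k, P, hP, hs⟩ := hs
  rw [EReal.coe_lt_coe_iff] at hs
  set h := ⨅ n : ℕ, partHn f μ P (n + 1) / ((n : ℝ) + 1) with hh
  have hle : ∀ n : ℕ, h * ((n : ℝ) + 1) ≤ partHn f μ P (n + 1) := by
    intro n
    rw [← le_div_iff₀ (by positivity)]
    refine ciInf_le ⟨0, ?_⟩ n
    rintro _ ⟨n, rfl⟩
    exact div_nonneg (partHn_nonneg _) (by positivity)
  have hXne : Nonempty X := nonempty_of_isProbabilityMeasure μ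
  have hk : (1 : ℝ) ≤ k := by exact_mod_cast (P hXne.some).pos
  set η := (h - s) / 5 with hη
  have hη0 : 0 < η := by simp only [hη]; linarith
  obtain ⟨u₀, hu₀⟩ := exists_nat_gt (Real.log 2 / η)
  have hlog2 : 0 < Real.log 2 := Real.log_pos (by norm_num)
  have hu₀' : Real.log 2 ≤ u₀ * η := by rw [div_lt_iff₀ hη0] at hu₀; exact hu₀.le
  have hu₀pos : 0 < u₀ := by
    rcases Nat.eq_zero_or_pos u₀ with h0 | h0
    · rw [h0] at hu₀'; norm_num at hu₀'; linarith
    · exact h0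
  set κ := 1 - Real.exp (-η) with hκ
  have hκ1 : κ < 1 := by have := Real.exp_pos (-η); linarith
  have hκ0 : 0 < κ := by
    have : Real.exp (-η) < 1 := Real.exp_lt_one_iff.2 (by linarith)
    linarith
  have hlogκ : Real.log (1 - κ) = -η := by
    rw [hκ, sub_sub_cancel, Real.log_exp]
  have hL1 : 0 ≤ Real.log (k / κ) := Real.log_nonneg (by rw [le_div_iff₀ hκ0]; linarith)
  have hL2 : 0 ≤ Real.log (2 * k) := Real.log_nonneg (by linarith)
  have hδL : ∀ L : ℝ, 0 ≤ L → η / (L + 1) * L ≤ η := fun L hL => by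
    rw [div_mul_eq_mul_div, div_le_iff₀ (by linarith)]
    nlinarith
  obtain ⟨K, hKc, hKμ, ε, hε, hKP⟩ := exists_closed_partition_approx μ hP
    (δ := η / (Real.log (k / κ) + 1)) (by positivity)
  refine ⟨ε / 2, by positivity, η / (Real.log (2 * k) + 1), by positivity,
    min 1 (Real.exp (-s * u₀)), by positivity, fun G hGm hG ι F y u hcov => ?_⟩
  by_contra! hlt
  have hu : ∀ i ∈ F, u₀ ≤ u i := by
    intro i hi
    by_contra! hui
    have h1 := Finset.single_le_sum (f := fun i => Real.exp (-s * u i))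
      (fun j _ => (Real.exp_pos _).le) hi
    have h2 : Real.exp (-s * u₀) ≤ Real.exp (-s * u i) := by
      rw [Real.exp_le_exp]
      have : (u i : ℝ) ≤ u₀ := by exact_mod_cast hui.le
      nlinarith
    have h3 := min_le_right 1 (Real.exp (-s * u₀))
    linarith
  classical
  let W : ι → List (Fin k) := fun i => List.ofFn fun j : Fin (u i) =>
    if h : ∃ x ∈ dynBall f (y i) (u i) (ε / 2), f^[(j : ℕ)] x ∈ K
      then P (f^[(j : ℕ)] h.choose) else P (y i)
  have hWl : ∀ i, (W i).length = u i := fun i => by simp [W]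
  have hW : ∀ i x, x ∈ dynBall f (y i) (u i) (ε / 2) → NameAgrees f P K x (W i) := by
    intro i x hx j hj hjK
    have hj' : j < u i := by rwa [hWl] at hj
    have hex : ∃ x ∈ dynBall f (y i) (u i) (ε / 2), f^[j] x ∈ K := ⟨x, hx, hjK⟩
    simp only [W, List.getElem_ofFn]
    rw [dif_pos hex]
    refine hKP _ hjK _ hex.choose_spec.2 ?_
    have h1 := hx j hj'
    have h2 := hex.choose_spec.1 j hj'
    have := dist_triangle_left (f^[j] x) (f^[j] hex.choose) (f^[j] (y i))
    linarith
  have hbound := partHn_le_of_tiles hf hP hKc.measurableSet hGm (F := F) (W := W) (s := s)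
    (θ := s + η) (U := (∑ i ∈ F, (u i : ℝ)) * (s + η)) hκ0 hκ1 (by positivity)
    (mul_nonneg (Finset.sum_nonneg fun _ _ => by positivity) (by positivity))
    (by simp only [hWl]; exact hlt.le.trans (min_le_left _ _))
    (fun i hi h0 => by
      have := hWl i
      rw [h0, List.length_nil] at this
      have := hu i hi
      omega)
    (fun i hi => by
      rw [hWl]
      have : (u₀ : ℝ) ≤ u i := by exact_mod_cast hu i hi
      nlinarith)
    (fun i hi => by
      rw [hWl]
      exact mul_le_mul_of_nonneg_right (Finset.single_le_sum (f := fun i => (u i : ℝ))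
        (fun j _ => by positivity) hi) (by positivity))
    (fun x hx => by
      obtain ⟨i, hi, hxi⟩ := mem_iUnion₂.1 (hcov hx)
      exact ⟨i, hi, hW i x hxi⟩)
  set U := (∑ i ∈ F, (u i : ℝ)) * (s + η)
  obtain ⟨N, hN⟩ := exists_nat_gt (U / η)
  rw [div_lt_iff₀ hη0] at hN
  have h1 := (hle N).trans (hbound (N + 1))
  have h2 : μ.real Kᶜ * Real.log (k / κ) ≤ η :=
    (mul_le_mul_of_nonneg_right hKμ hL1).trans (hδL _ hL1)
  have h3 : μ.real Gᶜ * Real.log (2 * k) ≤ η :=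
    (mul_le_mul_of_nonneg_right hG hL2).trans (hδL _ hL2)
  rw [hlogκ] at h1
  push_cast at h1
  have hs5 : h = s + 5 * η := by simp only [hη]; ring
  have hN0 : (0 : ℝ) ≤ N := by positivity
  have h4 : ((N : ℝ) + 1) * (s + η - -η + μ.real Kᶜ * Real.log (k / κ) +
      μ.real Gᶜ * Real.log (2 * k)) ≤ (N + 1) * (s + 4 * η) :=
    mul_le_mul_of_nonneg_left (by linarith) (by linarith)
  rw [hs5] at h1
  nlinarith

section CocycleBasics

variable {X : Type*} {m : ℕ}

/-- The logarithmic growth `log ‖A(x,n)‖` of the cocycle. -/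
noncomputable def logGrowth (f : X → X) (A : X → (Em m ≃L[ℝ] Em m)) (n : ℕ) (x : X) : ℝ :=
  Real.log ‖cocycle f A x n‖

/-- `e^L` bounds the generator of the cocycle and its inverse. -/
def IsGenBound (A : X → (Em m ≃L[ℝ] Em m)) (L : ℝ) : Prop :=
  0 ≤ L ∧ ∀ x, ‖(A x : Em m →L[ℝ] Em m)‖ ≤ Real.exp L ∧
    ‖((A x).symm : Em m →L[ℝ] Em m)‖ ≤ Real.exp L

variable {f : X → X} {A : X → (Em m ≃L[ℝ] Em m)} {L : ℝ}

theorem cocycle_add (x : X) (n p : ℕ) :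
    cocycle f A x (n + p) = (cocycle f A (f^[n] x) p).comp (cocycle f A x n) := by
  induction p with
  | zero => rfl
  | succ p ih =>
    rw [← add_assoc, cocycle, ih, cocycle, ← Function.iterate_add_apply, add_comm p n]
    rfl

theorem norm_cocycle_add_le (x : X) (n p : ℕ) :
    ‖cocycle f A x (n + p)‖ ≤ ‖cocycle f A (f^[n] x) p‖ * ‖cocycle f A x n‖ := by
  rw [cocycle_add]
  exact ContinuousLinearMap.opNorm_comp_le _ _

theorem norm_cocycle_le_succ (hL : IsGenBound A L) (x : X) (n : ℕ) :
    ‖cocycle f A x n‖ ≤ Real.exp L * ‖cocycle f A x (n + 1)‖ := by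
  have h : cocycle f A x n =
      ((A (f^[n] x)).symm : Em m →L[ℝ] Em m).comp (cocycle f A x (n + 1)) := by
    ext v; simp [cocycle]
  calc ‖cocycle f A x n‖ ≤ ‖((A (f^[n] x)).symm : Em m →L[ℝ] Em m)‖ *
        ‖cocycle f A x (n + 1)‖ := by
          conv_lhs => rw [h]
          exact ContinuousLinearMap.opNorm_comp_le _ _
    _ ≤ _ := by gcongr; exact (hL.2 _).2

theorem norm_cocycle_map_le_succ (hL : IsGenBound A L) (x : X) (n : ℕ) :
    ‖cocycle f A (f x) n‖ ≤ ‖cocycle f A x (n + 1)‖ * Real.exp L := by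
  have h : cocycle f A (f x) n =
      (cocycle f A x (n + 1)).comp ((A x).symm : Em m →L[ℝ] Em m) := by
    rw [add_comm n 1, cocycle_add]; ext v; simp [cocycle]
  calc ‖cocycle f A (f x) n‖ ≤ ‖cocycle f A x (n + 1)‖ *
        ‖((A x).symm : Em m →L[ℝ] Em m)‖ := by
          conv_lhs => rw [h]
          exact ContinuousLinearMap.opNorm_comp_le _ _
    _ ≤ _ := by gcongr; exact (hL.2 _).2

theorem norm_cocycle_pos [NeZero m] (x : X) (n : ℕ) : 0 < ‖cocycle f A x n‖ := by
  have : ∀ n, Function.Injective (cocycle f A x n) := by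
    intro n
    induction n with
    | zero => exact fun _ _ h => h
    | succ n ih =>
      intro v w h
      exact ih ((A (f^[n] x)).injective h)
  rw [norm_pos_iff]
  intro h0
  obtain ⟨v, hv⟩ := exists_ne (0 : Em m)
  refine hv (this n ?_)
  rw [h0]; rfl

theorem logGrowth_zero [NeZero m] (x : X) : logGrowth f A 0 x = 0 := by
  simp [logGrowth, cocycle]

theorem logGrowth_add_le [NeZero m] (x : X) (n p : ℕ) :
    logGrowth f A (n + p) x ≤ logGrowth f A n x + logGrowth f A p (f^[n] x) := by
  unfold logGrowth
  rw [add_comm (Real.log _), ← Real.log_mul (norm_cocycle_pos _ _).ne' (norm_cocycle_pos _ _).ne']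
  exact Real.log_le_log (norm_cocycle_pos _ _) (norm_cocycle_add_le _ _ _)

theorem logGrowth_le_add [NeZero m] (hL : IsGenBound A L) (x : X) (n p : ℕ) :
    logGrowth f A n x ≤ logGrowth f A (n + p) x + p * L := by
  induction p with
  | zero => simp
  | succ p ih =>
    have h := Real.log_le_log (norm_cocycle_pos (f := f) (A := A) x (n + p))
      (norm_cocycle_le_succ hL x (n + p))
    rw [Real.log_mul (Real.exp_pos _).ne' (norm_cocycle_pos _ _).ne', Real.log_exp] at h
    have h' : logGrowth f A (n + p) x ≤ L + logGrowth f A (n + (p + 1)) x := h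
    push_cast
    linarith

theorem logGrowth_iterate_le_add [NeZero m] (hL : IsGenBound A L) (x : X) (n p : ℕ) :
    logGrowth f A p (f^[n] x) ≤ logGrowth f A (n + p) x + n * L := by
  induction n generalizing x with
  | zero => simp
  | succ n ih =>
    have h := Real.log_le_log (norm_cocycle_pos (f := f) (A := A) (f x) (n + p))
      (norm_cocycle_map_le_succ hL x (n + p))
    rw [Real.log_mul (norm_cocycle_pos _ _).ne' (Real.exp_pos _).ne', Real.log_exp] at h
    have h' : logGrowth f A (n + p) (f x) ≤ logGrowth f A (n + p + 1) x + L := h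
    have := ih (f x)
    rw [add_right_comm]
    push_cast
    rw [Function.iterate_succ_apply]
    linarith

theorem abs_logGrowth_le [NeZero m] (hL : IsGenBound A L) (n : ℕ) (x : X) :
    |logGrowth f A n x| ≤ n * L := by
  rw [abs_le]
  constructor
  · have := logGrowth_le_add (f := f) hL x 0 n
    rw [logGrowth_zero, zero_add] at this
    linarith
  · induction n with
    | zero => simp [logGrowth_zero]
    | succ n ih =>
      have h1 := logGrowth_add_le (f := f) (A := A) x n 1
      have h2 : logGrowth f A 1 (f^[n] x) ≤ L := by
        unfold logGrowth
        rw [← Real.log_exp L]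
        refine Real.log_le_log (norm_cocycle_pos _ _) ?_
        simpa [cocycle] using (hL.2 (f^[n] x)).1
      push_cast
      linarith

/-- Averaged subadditivity: `log ‖A(x,n)‖` is controlled by the Birkhoff sum of
`k⁻¹ log ‖A(·,k)‖`. -/
theorem logGrowth_le_birkhoffSum [NeZero m] (hL : IsGenBound A L) {k : ℕ} (hk : 0 < k)
    (x : X) (n : ℕ) :
    logGrowth f A n x ≤ birkhoffSum f (fun y => logGrowth f A k y / k) n x + 2 * k * L := by
  have key : ∀ n, ∑ r ∈ Finset.range k, logGrowth f A (n + r) x ≤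
      ∑ r ∈ Finset.range k, logGrowth f A r x + birkhoffSum f (logGrowth f A k) n x := by
    intro n
    induction n with
    | zero => simp
    | succ n ih =>
      have h1 : ∑ r ∈ Finset.range k, logGrowth f A (n + 1 + r) x + logGrowth f A n x =
          ∑ r ∈ Finset.range k, logGrowth f A (n + r) x + logGrowth f A (n + k) x := by
        rw [← Finset.sum_range_succ (fun r => logGrowth f A (n + r) x) k,
          Finset.sum_range_succ' (fun r => logGrowth f A (n + r) x) k]
        simp [add_assoc, add_comm 1]
      have h2 := logGrowth_add_le (f := f) (A := A) x n k
      rw [birkhoffSum_succ]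
      linarith
  have h1 : ∑ r ∈ Finset.range k, (logGrowth f A n x - k * L) ≤
      ∑ r ∈ Finset.range k, logGrowth f A (n + r) x := by
    refine Finset.sum_le_sum fun r hr => ?_
    have h2 := logGrowth_le_add (f := f) hL x n r
    have h3 : (r : ℝ) ≤ k := by exact_mod_cast (Finset.mem_range.1 hr).le
    nlinarith [hL.1]
  have h2 : ∑ r ∈ Finset.range k, logGrowth f A r x ≤ ∑ r ∈ Finset.range k, (k * L) := by
    refine Finset.sum_le_sum fun r hr => ?_
    have h2 := (abs_le.1 (abs_logGrowth_le (f := f) hL r x)).2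
    have h3 : (r : ℝ) ≤ k := by exact_mod_cast (Finset.mem_range.1 hr).le
    nlinarith [hL.1]
  have h3 : birkhoffSum f (fun y => logGrowth f A k y / k) n x =
      birkhoffSum f (logGrowth f A k) n x / k := by
    simp [birkhoffSum, Finset.sum_div]
  have hk' : (0 : ℝ) < k := by exact_mod_cast hk
  have h4 := key n
  simp only [Finset.sum_const, Finset.card_range, nsmul_eq_mul] at h1 h2
  rw [h3, ← sub_le_iff_le_add, le_div_iff₀ hk']
  nlinarith

theorem continuous_of_holderMat [MetricSpace X] (hA : HolderMat A) :
    Continuous fun x => (A x : Em m →L[ℝ] Em m) := by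
  obtain ⟨α, C, hα, hC, h⟩ := hA
  rw [continuous_iff_continuousAt]
  intro x
  rw [ContinuousAt, tendsto_iff_norm_sub_tendsto_zero]
  have h1 : Tendsto (fun y => C * dist y x ^ α) (𝓝 x) (𝓝 (C * dist x x ^ α)) := by
    refine Tendsto.const_mul _ (Tendsto.rpow_const ?_ (Or.inr hα.le))
    exact (continuous_id.dist continuous_const).tendsto x
  rw [dist_self, Real.zero_rpow hα.ne', mul_zero] at h1
  exact squeeze_zero (fun _ => norm_nonneg _) (fun y => h y x) h1

theorem exists_isGenBound [MetricSpace X] [CompactSpace X]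
    (hA : Continuous fun x => (A x : Em m →L[ℝ] Em m)) : ∃ L, IsGenBound A L := by
  have hinv : Continuous fun x => ((A x).symm : Em m →L[ℝ] Em m) := by
    rw [continuous_iff_continuousAt]
    intro x
    have h1 : ContinuousAt ContinuousLinearMap.inverse (A x : Em m →L[ℝ] Em m) :=
      (contDiffAt_map_inverse (𝕜 := ℝ) (n := 0) (A x)).continuousAt
    have h2 := ContinuousAt.comp (f := fun x => (A x : Em m →L[ℝ] Em m)) h1 hA.continuousAt
    simpa [Function.comp_def, ContinuousLinearMap.inverse_equiv] using h2
  obtain ⟨B, hB⟩ := isCompact_univ.exists_bound_of_continuousOn hA.continuousOn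
  obtain ⟨B', hB'⟩ := isCompact_univ.exists_bound_of_continuousOn hinv.continuousOn
  have hm : ∀ y, y ≤ max (max B B') 1 → y ≤ Real.exp (Real.log (max (max B B') 1)) := by
    intro y hy
    rwa [Real.exp_log (lt_of_lt_of_le one_pos (le_max_right _ _))]
  exact ⟨Real.log (max (max B B') 1), Real.log_nonneg (le_max_right _ _), fun x =>
    ⟨hm _ ((hB x trivial).trans ((le_max_left _ _).trans (le_max_left _ _))),
      hm _ ((hB' x trivial).trans ((le_max_right _ _).trans (le_max_left _ _)))⟩⟩

theorem continuous_logGrowth [NeZero m] [TopologicalSpace X] (hf : Continuous f)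
    (hA : Continuous fun x => (A x : Em m →L[ℝ] Em m)) (n : ℕ) :
    Continuous (logGrowth f A n) := by
  have : Continuous fun x => cocycle f A x n := by
    induction n with
    | zero => exact continuous_const
    | succ n ih => exact (hA.comp (hf.iterate n)).clm_comp ih
  exact this.norm.log fun x => (norm_cocycle_pos x n).ne'

theorem mle_le [NeZero m] [MeasurableSpace X] (hL : IsGenBound A L) (μ : Measure X)
    [IsProbabilityMeasure μ] {n : ℕ} (hn : 0 < n) :
    mle f A μ * n ≤ ∫ x, logGrowth f A n x ∂μ := by
  obtain ⟨n, rfl⟩ : ∃ k, n = k + 1 := ⟨n - 1, by omega⟩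
  rw [← le_div_iff₀ (by positivity)]
  push_cast
  refine ciInf_le ⟨-L, ?_⟩ n
  rintro _ ⟨n, rfl⟩
  simp only
  rw [le_div_iff₀ (by positivity)]
  have : ‖∫ x, logGrowth f A (n + 1) x ∂μ‖ ≤ ((n + 1 : ℕ) : ℝ) * L * μ.real univ :=
    norm_integral_le_of_norm_le_const (.of_forall fun x => abs_logGrowth_le hL _ x)
  rw [probReal_univ, mul_one, Real.norm_eq_abs, abs_le] at this
  push_cast at this
  have h1 := this.1
  simp only [logGrowth] at h1
  linarith

theorem exists_integral_lt_mle_add [MeasurableSpace X] (f : X → X)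
    (A : X → (Em m ≃L[ℝ] Em m)) (μ : Measure X) {ε : ℝ} (hε : 0 < ε) :
    ∃ k : ℕ, 0 < k ∧ ∫ x, logGrowth f A k x / k ∂μ < mle f A μ + ε := by
  obtain ⟨k, hk⟩ := exists_lt_of_ciInf_lt (lt_add_of_pos_right (mle f A μ) hε)
  refine ⟨k + 1, k.succ_pos, ?_⟩
  rw [integral_div]
  push_cast
  exact hk

end CocycleBasics

section CocyclePerturbation

variable {X : Type*} {m : ℕ} {f : X → X} {A : X → (Em m ≃L[ℝ] Em m)} {L : ℝ}

theorem norm_cocycle_sub_le (x z : X) (p : ℕ) :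
    ‖cocycle f A z p - cocycle f A x p‖ ≤ ∑ i ∈ Finset.range p,
      ‖cocycle f A (f^[i + 1] z) (p - (i + 1))‖ *
        ‖(A (f^[i] z) : Em m →L[ℝ] Em m) - (A (f^[i] x) : Em m →L[ℝ] Em m)‖ *
        ‖cocycle f A x i‖ := by
  have h : cocycle f A z p - cocycle f A x p = ∑ i ∈ Finset.range p,
      ((cocycle f A (f^[i + 1] z) (p - (i + 1))).comp
        ((A (f^[i] z) : Em m →L[ℝ] Em m) - (A (f^[i] x) : Em m →L[ℝ] Em m))).comp
        (cocycle f A x i) := by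
    have h1 := Finset.sum_range_sub'
      (fun i => (cocycle f A (f^[i] z) (p - i)).comp (cocycle f A x i)) p
    have h2 : cocycle f A z p - cocycle f A x p =
        (cocycle f A (f^[0] z) (p - 0)).comp (cocycle f A x 0) -
        (cocycle f A (f^[p] z) (p - p)).comp (cocycle f A x p) := by
      rw [Nat.sub_self]; rfl
    rw [h2, ← h1]
    refine Finset.sum_congr rfl fun i hi => ?_
    have hi := Finset.mem_range.1 hi
    have h3 : p - i = 1 + (p - (i + 1)) := by omega
    rw [h3, cocycle_add, ← Function.iterate_add_apply, add_comm 1 i]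
    ext1 v
    simp [cocycle]
  rw [h]
  refine (norm_sum_le _ _).trans (Finset.sum_le_sum fun i _ => ?_)
  refine (ContinuousLinearMap.opNorm_comp_le _ _).trans ?_
  gcongr
  exact ContinuousLinearMap.opNorm_comp_le _ _

theorem birkhoffSum_le_add_of_close {φ : X → ℝ} {ε : ℝ} {n : ℕ} {x z : X}
    (h : ∀ t < n, |φ (f^[t] z) - φ (f^[t] x)| ≤ ε) :
    birkhoffSum f φ n z ≤ birkhoffSum f φ n x + n * ε := by
  have h1 : ∑ t ∈ Finset.range n, φ (f^[t] z) ≤ ∑ t ∈ Finset.range n, (φ (f^[t] x) + ε) :=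
    Finset.sum_le_sum fun t ht => by
      have := (abs_le.1 (h t (Finset.mem_range.1 ht))).2
      linarith
  rw [Finset.sum_add_distrib] at h1
  simpa [birkhoffSum] using h1

theorem abs_birkhoffSum_le {φ : X → ℝ} (hφ : ∀ y, |φ y| ≤ L) (n : ℕ) (x : X) :
    |birkhoffSum f φ n x| ≤ n * L := by
  refine (Finset.abs_sum_le_sum_abs _ _).trans ?_
  simpa using Finset.sum_le_sum (s := Finset.range n) fun t _ => hφ (f^[t] x)

/-- Growth along an orbit that exponentially shadows a typical orbit segment. -/
theorem logGrowth_lower_of_shadow [NeZero m] (hL : IsGenBound A L) {φ : X → ℝ}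
    (hφ : ∀ y, |φ y| ≤ L) {C : ℝ}
    (hC : ∀ y n, logGrowth f A n y ≤ birkhoffSum f φ n y + C) {ε D : ℝ}
    {n a : ℕ} (ha : 2 * a ≤ n) {x z : X} (hD : 0 ≤ D)
    (hclose : ∀ t < n, |φ (f^[t] z) - φ (f^[t] x)| ≤ ε) (hε : 0 ≤ ε)
    (hAclose : ∀ t, a ≤ t → t < n - a →
      ‖(A (f^[t] z) : Em m →L[ℝ] Em m) - (A (f^[t] x) : Em m →L[ℝ] Em m)‖ ≤ D)
    (hx : birkhoffSum f φ n x ≤ logGrowth f A n x + ε * n)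
    (hsmall : 2 * n * D * Real.exp (L + 2 * n * ε + 4 * C) ≤ 1) :
    birkhoffSum f φ n x - 4 * a * L - ε * n - 2 * C - Real.log 2 ≤ logGrowth f A n z := by
  obtain ⟨p, hp⟩ : ∃ p, n = a + p + a := ⟨n - 2 * a, by omega⟩
  have hpn : (p : ℝ) ≤ n := by rw [hp]; push_cast; nlinarith [Nat.cast_nonneg (α := ℝ) a]
  set S := birkhoffSum f φ p (f^[a] x) with hS
  have hsplit : birkhoffSum f φ n x =
      birkhoffSum f φ a x + S + birkhoffSum f φ a (f^[a + p] x) := by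
    rw [hp, birkhoffSum_add, birkhoffSum_add]
  -- lower bound for the middle block along `x`
  have hmid : S - ε * n - 2 * C ≤ logGrowth f A p (f^[a] x) := by
    have h1 := logGrowth_add_le (f := f) (A := A) x (a + p) a
    have h2 := logGrowth_add_le (f := f) (A := A) x a p
    rw [← hp] at h1
    have h3 := hC x a
    have h4 := hC (f^[a + p] x) a
    linarith
  -- the middle blocks along `x` and `z` are close
  have hdiff : ‖cocycle f A (f^[a] z) p - cocycle f A (f^[a] x) p‖ ≤
      Real.exp (S - ε * n - 2 * C) / 2 := by
    have hterm : ∀ i ∈ Finset.range p,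
        ‖cocycle f A (f^[i + 1] (f^[a] z)) (p - (i + 1))‖ *
        ‖(A (f^[i] (f^[a] z)) : Em m →L[ℝ] Em m) - (A (f^[i] (f^[a] x)) : Em m →L[ℝ] Em m)‖ *
        ‖cocycle f A (f^[a] x) i‖ ≤ D * Real.exp (S + L + n * ε + 2 * C) := by
      intro i hi
      have hi := Finset.mem_range.1 hi
      have hnorm : ∀ y q, ‖cocycle f A y q‖ ≤ Real.exp (birkhoffSum f φ q y + C) := fun y q => by
        rw [← Real.log_le_iff_le_exp (norm_cocycle_pos _ _)]
        exact hC y q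
      have h1 := hnorm (f^[i + 1] (f^[a] z)) (p - (i + 1))
      have h2 := hnorm (f^[a] x) i
      have h3 : birkhoffSum f φ (p - (i + 1)) (f^[i + 1] (f^[a] z)) ≤
          birkhoffSum f φ (p - (i + 1)) (f^[i + 1] (f^[a] x)) + ((p - (i + 1) : ℕ) : ℝ) * ε :=
        birkhoffSum_le_add_of_close fun t ht => by
          rw [← Function.iterate_add_apply, ← Function.iterate_add_apply,
            ← Function.iterate_add_apply, ← Function.iterate_add_apply]
          exact hclose _ (by omega)
      have h4 : ((p - (i + 1) : ℕ) : ℝ) * ε ≤ n * ε := by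
        gcongr; omega
      have h5 : S = birkhoffSum f φ i (f^[a] x) + φ (f^[i] (f^[a] x)) +
          birkhoffSum f φ (p - (i + 1)) (f^[i + 1] (f^[a] x)) := by
        rw [← birkhoffSum_succ, ← birkhoffSum_add, hS]
        congr 1; omega
      have h6 := (abs_le.1 (hφ (f^[i] (f^[a] x)))).1
      have h7 : ‖(A (f^[i] (f^[a] z)) : Em m →L[ℝ] Em m) -
          (A (f^[i] (f^[a] x)) : Em m →L[ℝ] Em m)‖ ≤ D := by
        rw [← Function.iterate_add_apply, ← Function.iterate_add_apply]
        exact hAclose _ (by omega) (by omega)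
      calc _ ≤ Real.exp (birkhoffSum f φ (p - (i + 1)) (f^[i + 1] (f^[a] z)) + C) * D *
            Real.exp (birkhoffSum f φ i (f^[a] x) + C) := by gcongr
        _ = D * Real.exp (birkhoffSum f φ (p - (i + 1)) (f^[i + 1] (f^[a] z)) + C +
            (birkhoffSum f φ i (f^[a] x) + C)) := by rw [Real.exp_add (_ + C) (_ + C)]; ring
        _ ≤ _ := by gcongr D * Real.exp ?_; linarith
    refine (norm_cocycle_sub_le _ _ _).trans ((Finset.sum_le_sum hterm).trans ?_)
    rw [Finset.sum_const, Finset.card_range, nsmul_eq_mul, le_div_iff₀ two_pos]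
    have h8 : Real.exp (S + L + n * ε + 2 * C) =
        Real.exp (L + 2 * n * ε + 4 * C) * Real.exp (S - ε * n - 2 * C) := by
      rw [← Real.exp_add]; congr 1; ring
    calc (p : ℝ) * (D * Real.exp (S + L + n * ε + 2 * C)) * 2
        ≤ (n : ℝ) * (D * Real.exp (S + L + n * ε + 2 * C)) * 2 := by gcongr
      _ = (2 * n * D * Real.exp (L + 2 * n * ε + 4 * C)) * Real.exp (S - ε * n - 2 * C) := by
          rw [h8]; ring
      _ ≤ 1 * Real.exp (S - ε * n - 2 * C) := by gcongr
      _ = _ := one_mul _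
  have hmidz : S - ε * n - 2 * C - Real.log 2 ≤ logGrowth f A p (f^[a] z) := by
    rw [logGrowth, Real.le_log_iff_exp_le (norm_cocycle_pos _ _), Real.exp_sub,
      Real.exp_log two_pos]
    have h1 : Real.exp (S - ε * n - 2 * C) ≤ ‖cocycle f A (f^[a] x) p‖ := by
      rwa [← Real.le_log_iff_exp_le (norm_cocycle_pos _ _)]
    have h2 : ‖cocycle f A (f^[a] x) p‖ ≤ ‖cocycle f A (f^[a] z) p‖ +
        ‖cocycle f A (f^[a] z) p - cocycle f A (f^[a] x) p‖ := norm_le_insert _ _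
    linarith
  have h1 := logGrowth_iterate_le_add (f := f) hL z a p
  have h2 := logGrowth_le_add (f := f) hL z (a + p) a
  rw [← hp] at h2
  have h3 := (abs_le.1 (abs_birkhoffSum_le (f := f) hφ a x)).2
  have h4 := (abs_le.1 (abs_birkhoffSum_le (f := f) hφ a (f^[a + p] x))).2
  linarith

end CocyclePerturbation

section PhaseLemma

variable {X : Type*} [MetricSpace X] [CompactSpace X] [MeasurableSpace X] [BorelSpace X] {m : ℕ}
  {f : X → X} {A : X → (Em m ≃L[ℝ] Em m)} {L : ℝ}

/-- Large sets of points whose finite-time averages of `k⁻¹ log ‖A(·,k)‖` and whose finite-time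
growth are both close to the exponent of the measure. -/
theorem exists_typical_sets [NeZero m] (hf : Continuous f) (hL : IsGenBound A L)
    (hA : Continuous fun x => (A x : Em m →L[ℝ] Em m)) (μ : Measure X) [IsProbabilityMeasure μ]
    (he : Ergodic f μ) {ε δ : ℝ} (hε : 0 < ε) (hδ : 0 < δ) :
    ∃ (φ : X → ℝ) (C : ℝ) (G : ℕ → Set X), Continuous φ ∧ (∀ y, |φ y| ≤ L) ∧
      (∀ y n, logGrowth f A n y ≤ birkhoffSum f φ n y + C) ∧ (∀ n, MeasurableSet (G n)) ∧
      (∀ᶠ n in atTop, μ.real (G n)ᶜ ≤ δ) ∧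
      ∀ n, ∀ x ∈ G n, |birkhoffSum f φ n x - n * mle f A μ| ≤ 2 * ε * n ∧
        birkhoffSum f φ n x ≤ logGrowth f A n x + ε * n := by
  obtain ⟨k, hk, hkint⟩ := exists_integral_lt_mle_add f A μ
    (ε := min ε (δ * ε / 4)) (by positivity)
  have hk' : (0 : ℝ) < k := by exact_mod_cast hk
  set φ : X → ℝ := fun y => logGrowth f A k y / k with hφdef
  have hφc : Continuous φ := (continuous_logGrowth hf hA k).div_const _
  have hφL : ∀ y, |φ y| ≤ L := fun y => by
    rw [hφdef]
    simp only
    rw [abs_div, Nat.abs_cast, div_le_iff₀ hk', mul_comm]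
    exact abs_logGrowth_le hL k y
  have hφC : ∀ y n, logGrowth f A n y ≤ birkhoffSum f φ n y + 2 * k * L := fun y n =>
    logGrowth_le_birkhoffSum hL hk y n
  set C := 2 * k * L with hCdef
  have hC0 : 0 ≤ C := by have := hL.1; positivity
  have hφint : Integrable φ μ := hφc.integrable_of_hasCompactSupport
    (HasCompactSupport.of_compactSpace _)
  have hmle : mle f A μ ≤ ∫ x, φ x ∂μ := by
    rw [hφdef, integral_div, le_div_iff₀ hk']
    exact mle_le hL μ hk
  have hSc : ∀ n, Continuous (birkhoffSum f φ n) := fun n =>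
    continuous_finsetSum _ fun i _ => hφc.comp (hf.iterate i)
  set I := ∫ x, φ x ∂μ with hI
  have hm1 : ∀ n : ℕ, MeasurableSet {x | |birkhoffSum f φ n x - n * I| ≤ ε * n} := fun n =>
    (isClosed_le ((hSc n).sub continuous_const).abs continuous_const).measurableSet
  have hm2 : ∀ n : ℕ, MeasurableSet {x | birkhoffSum f φ n x ≤ logGrowth f A n x + ε * n} :=
    fun n => (isClosed_le (hSc n)
      ((continuous_logGrowth hf hA n).add continuous_const)).measurableSet
  refine ⟨φ, C, fun n => {x | |birkhoffSum f φ n x - n * I| ≤ ε * n} ∩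
    {x | birkhoffSum f φ n x ≤ logGrowth f A n x + ε * n}, hφc, hφL, hφC,
    fun n => (hm1 n).inter (hm2 n), ?_, ?_⟩
  · have hmem : MemLp φ 2 μ := MemLp.of_bound hφc.aestronglyMeasurable L (.of_forall hφL)
    have h1 := he.tendstoInMeasure_birkhoffAverage hmem
    rw [tendstoInMeasure_iff_measureReal_dist] at h1
    have h2 := (h1 ε hε).eventually (ge_mem_nhds (show (0 : ℝ) < δ / 2 by positivity))
    have h3 : Tendsto (fun n : ℕ => C / (ε * n)) atTop (𝓝 0) :=
      tendsto_const_nhds.div_atTop (tendsto_natCast_atTop_atTop.const_mul_atTop hε)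
    have h4 := h3.eventually (ge_mem_nhds (show (0 : ℝ) < δ / 4 by positivity))
    filter_upwards [h2, h4, eventually_gt_atTop 0] with n hn hn' hn0
    have hn0' : (0 : ℝ) < n := by exact_mod_cast hn0
    rw [compl_inter]
    refine (measureReal_union_le _ _).trans ?_
    have e1 : μ.real {x | |birkhoffSum f φ n x - n * I| ≤ ε * n}ᶜ ≤ δ / 2 := by
      refine (measureReal_mono fun x hx => ?_).trans hn
      simp only [mem_compl_iff, mem_ofPred_eq, not_le] at hx ⊢
      rw [birkhoffAverage, Real.dist_eq, smul_eq_mul]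
      have : (n : ℝ)⁻¹ * birkhoffSum f φ n x - I = (birkhoffSum f φ n x - n * I) / n := by
        field_simp
      rw [this, abs_div, Nat.abs_cast, le_div_iff₀ hn0']
      exact hx.le
    have e2 : μ.real {x | birkhoffSum f φ n x ≤ logGrowth f A n x + ε * n}ᶜ ≤ δ / 2 := by
      have hint1 := integral_birkhoffSum he.toMeasurePreserving hφint n
      have hint2 : Integrable (logGrowth f A n) μ :=
        (continuous_logGrowth hf hA n).integrable_of_hasCompactSupport
          (HasCompactSupport.of_compactSpace _)
      set g : X → ℝ := fun x => birkhoffSum f φ n x - logGrowth f A n x + C with hg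
      have hg0 : 0 ≤ᵐ[μ] g := .of_forall fun x => by
        have := hφC x n
        simp only [hg, Pi.zero_apply]; linarith
      have hgint : Integrable g μ := (hint1.1.sub hint2).add (integrable_const _)
      have hgval : ∫ x, g x ∂μ ≤ n * (δ * ε / 4) + C := by
        have e3 : ∫ x, g x ∂μ = ∫ x, (birkhoffSum f φ n x - logGrowth f A n x) ∂μ + ∫ _, C ∂μ :=
          integral_add (hint1.1.sub hint2) (integrable_const _)
        rw [e3, integral_sub hint1.1 hint2, hint1.2, integral_const, probReal_univ, one_smul]
        have := mle_le (f := f) hL μ hn0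
        have : I < mle f A μ + δ * ε / 4 := hkint.trans_le (by gcongr; exact min_le_right _ _)
        nlinarith
      have hmk := mul_meas_ge_le_integral_of_nonneg hg0 hgint (ε * n)
      have hsub : μ.real {x | birkhoffSum f φ n x ≤ logGrowth f A n x + ε * n}ᶜ ≤
          μ.real {x | ε * n ≤ g x} := by
        refine measureReal_mono fun x hx => ?_
        simp only [mem_compl_iff, mem_ofPred_eq, not_le] at hx ⊢
        simp only [hg]; linarith
      refine hsub.trans ?_
      have h5 : μ.real {x | ε * n ≤ g x} ≤ (n * (δ * ε / 4) + C) / (ε * n) := by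
        rw [le_div_iff₀ (by positivity), mul_comm]
        exact hmk.trans hgval
      refine h5.trans ?_
      rw [add_div]
      have : (n : ℝ) * (δ * ε / 4) / (ε * n) = δ / 4 := by field_simp
      rw [this]; linarith
    linarith
  · rintro n x ⟨hx1, hx2⟩
    refine ⟨?_, hx2⟩
    simp only [mem_ofPred_eq] at hx1
    have h1 : I ≤ mle f A μ + ε := hkint.le.trans (by gcongr; exact min_le_left _ _)
    have hn0 : (0 : ℝ) ≤ n := n.cast_nonneg
    rw [abs_le] at hx1 ⊢
    constructor <;> nlinarith

theorem exists_phase [NeZero m] (hf : Continuous f) (hA : HolderMat A) (μ : Measure X)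
    [IsProbabilityMeasure μ] (he : Ergodic f μ) {lam : ℝ} (hlam : 0 < lam) {ε δ : ℝ}
    (hε : 0 < ε) (hδ : 0 < δ) :
    ∃ τ > 0, ∃ G : ℕ → Set X, (∀ n, MeasurableSet (G n)) ∧
      (∀ᶠ n in atTop, μ.real (G n)ᶜ ≤ δ) ∧
      ∀ c : ℕ, ∀ᶠ n in atTop, ∀ x ∈ G n, ∀ z,
        (∀ j < n, dist (f^[c + j] z) (f^[j] x) ≤
          τ * Real.exp (-lam * ((min j (n - j) : ℕ) : ℝ))) →
        |logGrowth f A (c + n) z - (c + n : ℕ) * mle f A μ| ≤ ε * (c + n : ℕ) := by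
  have hAc := continuous_of_holderMat hA
  obtain ⟨L, hL⟩ := exists_isGenBound hAc
  obtain ⟨α, H, hα, hH, hHol⟩ := hA
  have hL0 := hL.1
  set χ := mle f A μ with hχ
  obtain ⟨κ, hκ0, hκ1, hκ2⟩ : ∃ κ : ℝ, 0 < κ ∧ κ ≤ 1 / 2 ∧ 4 * κ * L ≤ ε / 4 := by
    refine ⟨min (1 / 2) (ε / (16 * (L + 1))), by positivity, min_le_left _ _, ?_⟩
    have h1 : min (1 / 2) (ε / (16 * (L + 1))) ≤ ε / (16 * (L + 1)) := min_le_right _ _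
    rw [le_div_iff₀ (by positivity)] at h1
    have h2 : 0 < min (1 / 2) (ε / (16 * (L + 1))) := by positivity
    nlinarith
  obtain ⟨η, hη0, hη1, hη2⟩ : ∃ η : ℝ, 0 < η ∧ 3 * η ≤ ε / 4 ∧ 4 * η ≤ α * lam * κ :=
    ⟨min (ε / 12) (α * lam * κ / 4), by positivity,
      by linarith [min_le_left (ε / 12) (α * lam * κ / 4)],
      by linarith [min_le_right (ε / 12) (α * lam * κ / 4)]⟩
  obtain ⟨φ, C, G, hφc, hφL, hφC, hGm, hGμ, hG⟩ := exists_typical_sets hf hL hAc μ he hη0 hδ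
  obtain ⟨τ', hτ'0, hτ'⟩ := Metric.uniformContinuous_iff.1
    (CompactSpace.uniformContinuous_of_continuous hφc) η hη0
  have hC0 : 0 ≤ C := by
    by_cases hX : Nonempty X
    · obtain ⟨x⟩ := hX
      have := hφC x 0
      simpa [logGrowth_zero] using this
    · exact absurd (nonempty_of_isProbabilityMeasure μ) hX
  refine ⟨min 1 (τ' / 2), by positivity, G, hGm, hGμ, fun c => ?_⟩
  -- smallness of the accumulated error
  have hlim1 : ∀ᶠ n : ℕ in atTop,
      2 * n * (H * Real.exp (-(α * lam * (κ * n - 1)))) * Real.exp (L + 2 * n * η + 4 * C) ≤ 1 := by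
    have h1 : Tendsto (fun n : ℕ => (2 * H * Real.exp (L + 4 * C + α * lam)) *
        ((n : ℝ) * Real.exp (-(2 * η) * n))) atTop (𝓝 0) := by
      have h2 : Tendsto (fun x : ℝ => x ^ (1 : ℝ) * Real.exp (-(2 * η) * x)) atTop (𝓝 0) :=
        tendsto_rpow_mul_exp_neg_mul_atTop_nhds_zero 1 (2 * η) (by positivity)
      have h3 := (h2.comp (tendsto_natCast_atTop_atTop (R := ℝ))).const_mul
        (2 * H * Real.exp (L + 4 * C + α * lam))
      simpa [Function.comp_def] using h3
    filter_upwards [h1.eventually (ge_mem_nhds one_pos)] with n hn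
    refine le_trans ?_ hn
    have : (2 * H * Real.exp (L + 4 * C + α * lam)) * ((n : ℝ) * Real.exp (-(2 * η) * n)) =
      2 * n * H * Real.exp (L + 4 * C + α * lam + -(2 * η) * n) := by
        rw [Real.exp_add _ (-(2 * η) * n)]; ring
    rw [this]
    have : 2 * n * (H * Real.exp (-(α * lam * (κ * n - 1)))) * Real.exp (L + 2 * n * η + 4 * C) =
      2 * n * H * Real.exp (-(α * lam * (κ * n - 1)) + (L + 2 * n * η + 4 * C)) := by
        rw [Real.exp_add (-_)]; ring
    rw [this]
    gcongr 2 * n * H * Real.exp ?_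
    have := mul_le_mul_of_nonneg_right hη2 n.cast_nonneg
    linarith
  have hlim2 : ∀ᶠ n : ℕ in atTop,
      2 * C + Real.log 2 + c * L + c * |χ| ≤ ε / 4 * n :=
    (tendsto_natCast_atTop_atTop.const_mul_atTop (by positivity)).eventually_ge_atTop _
  filter_upwards [hlim1, hlim2] with n hn1 hn2 x hx w hw
  obtain ⟨hx1, hx2⟩ := hG n x hx
  have hn0 : (0 : ℝ) ≤ n := n.cast_nonneg
  set z := f^[c] w with hz
  have hw' : ∀ j < n, dist (f^[j] z) (f^[j] x) ≤
      min 1 (τ' / 2) * Real.exp (-lam * ((min j (n - j) : ℕ) : ℝ)) := fun j hj => by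
    rw [hz, ← Function.iterate_add_apply, add_comm j c]; exact hw j hj
  have hexp1 : ∀ j : ℕ, Real.exp (-lam * ((min j (n - j) : ℕ) : ℝ)) ≤ 1 := fun j => by
    rw [Real.exp_le_one_iff]
    have : (0 : ℝ) ≤ ((min j (n - j) : ℕ) : ℝ) := Nat.cast_nonneg _
    nlinarith
  have hclose : ∀ t < n, |φ (f^[t] z) - φ (f^[t] x)| ≤ η := fun t ht => by
    rw [← Real.dist_eq]
    refine (hτ' ?_).le
    calc dist (f^[t] z) (f^[t] x) ≤ _ := hw' t ht
      _ ≤ (τ' / 2) * 1 := by gcongr; exacts [min_le_right _ _, hexp1 t]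
      _ < τ' := by linarith
  set a := ⌊κ * n⌋₊ with ha
  have ha1 : (a : ℝ) ≤ κ * n := Nat.floor_le (by positivity)
  have ha2 : κ * n - 1 ≤ a := by have := Nat.lt_floor_add_one (κ * n); linarith
  have ha3 : 2 * a ≤ n := by
    have : (2 * a : ℝ) ≤ n := by
      have := mul_le_mul_of_nonneg_right hκ1 hn0
      linarith
    exact_mod_cast this
  have hAclose : ∀ t, a ≤ t → t < n - a →
      ‖(A (f^[t] z) : Em m →L[ℝ] Em m) - (A (f^[t] x) : Em m →L[ℝ] Em m)‖ ≤
        H * Real.exp (-(α * lam * (κ * n - 1))) := by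
    intro t ht1 ht2
    refine (hHol _ _).trans ?_
    have h1 : dist (f^[t] z) (f^[t] x) ≤ Real.exp (-lam * (κ * n - 1)) := by
      refine (hw' t (by omega)).trans ?_
      have h2 : (a : ℝ) ≤ ((min t (n - t) : ℕ) : ℝ) := by
        exact_mod_cast le_min ht1 (by omega)
      calc _ ≤ 1 * Real.exp (-lam * ((min t (n - t) : ℕ) : ℝ)) := by
            gcongr; exact min_le_left _ _
        _ ≤ _ := by
            rw [one_mul, Real.exp_le_exp, neg_mul, neg_mul, neg_le_neg_iff]
            gcongr
            exact ha2.trans h2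
    calc H * dist (f^[t] z) (f^[t] x) ^ α ≤ H * Real.exp (-lam * (κ * n - 1)) ^ α := by gcongr
      _ = _ := by rw [← Real.exp_mul]; congr 2; ring
  have hlow := logGrowth_lower_of_shadow (f := f) hL hφL hφC ha3 (by positivity) hclose hη0.le
    hAclose hx2 hn1
  have hup : logGrowth f A n z ≤ birkhoffSum f φ n x + n * η + C := by
    have := birkhoffSum_le_add_of_close hclose
    linarith [hφC z n]
  have h1 := logGrowth_add_le (f := f) (A := A) w c n
  have h2 := (abs_le.1 (abs_logGrowth_le (f := f) hL c w)).2
  have h3 := logGrowth_iterate_le_add (f := f) hL w c n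
  rw [← hz] at h1 h3
  have h4 : 4 * a * L ≤ ε / 4 * n := by
    have e1 := mul_le_mul_of_nonneg_right ha1 hL0
    have e2 := mul_le_mul_of_nonneg_right hκ2 hn0
    linarith
  have h5 : 3 * (η * n) ≤ ε / 4 * n := by
    have e1 := mul_le_mul_of_nonneg_right hη1 hn0
    linarith
  have h6 := abs_le.1 hx1
  have h7 : c * χ ≤ c * |χ| := by gcongr; exact le_abs_self _
  have h8 : -(c * |χ|) ≤ c * χ := by
    rw [← mul_neg]; gcongr; exact neg_abs_le _
  have h9 : 0 < Real.log 2 := Real.log_pos (by norm_num)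
  have h10 : 0 ≤ c * L := by positivity
  have h11 : 0 ≤ ε * c := by positivity
  have h12 : 0 ≤ ε * n := by positivity
  push_cast
  rw [abs_le]
  constructor <;> linarith

end PhaseLemma

section Gluing

variable {X : Type*} [MetricSpace X] [CompactSpace X]

/-- A topologically mixing map joins any two `δ`-balls in the same time `M`. -/
theorem exists_uniform_gap {f : X → X} (hmix : TopMixingOn f univ) {δ : ℝ} (hδ : 0 < δ) :
    ∃ M : ℕ, 1 ≤ M ∧ ∀ x y : X, ∃ z, dist x z < δ ∧ dist (f^[M] z) y < δ := by
  obtain ⟨t, -, htf, htc⟩ := finite_cover_balls_of_compact (isCompact_univ (X := X)) (half_pos hδ)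
  have h : ∀ p q : X, ∃ N : ℕ, ∀ n ≥ N, ∃ z, dist z p < δ / 2 ∧ dist (f^[n] z) q < δ / 2 := by
    intro p q
    obtain ⟨N, hN⟩ := hmix (Metric.ball p (δ / 2)) (Metric.ball q (δ / 2)) Metric.isOpen_ball
      Metric.isOpen_ball ⟨p, Metric.mem_ball_self (half_pos hδ), trivial⟩
      ⟨q, Metric.mem_ball_self (half_pos hδ), trivial⟩
    refine ⟨N, fun n hn => ?_⟩
    obtain ⟨_, ⟨z, ⟨hz, -⟩, rfl⟩, hz', -⟩ := hN n hn
    exact ⟨z, hz, hz'⟩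
  choose N hN using h
  set F := htf.toFinset
  refine ⟨(F ×ˢ F).sup (fun pq => N pq.1 pq.2) + 1, by omega, fun x y => ?_⟩
  obtain ⟨p, hp, hxp⟩ := mem_iUnion₂.1 (htc (mem_univ x))
  obtain ⟨q, hq, hyq⟩ := mem_iUnion₂.1 (htc (mem_univ y))
  have hle : N p q ≤ (F ×ˢ F).sup (fun pq => N pq.1 pq.2) :=
    Finset.le_sup (f := fun pq : X × X => N pq.1 pq.2) (b := (p, q))
      (Finset.mem_product.2 ⟨htf.mem_toFinset.2 hp, htf.mem_toFinset.2 hq⟩)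
  obtain ⟨z, hz1, hz2⟩ := hN p q _ (hle.trans (Nat.le_succ _))
  refine ⟨z, ?_, ?_⟩
  · have := dist_triangle_right x z p
    have h2 : dist x p < δ / 2 := hxp
    linarith
  · have := dist_triangle_right (f^[(F ×ˢ F).sup (fun pq => N pq.1 pq.2) + 1] z) y q
    have h2 : dist y q < δ / 2 := hyq
    exact lt_of_le_of_lt this (by linarith)

/-- The two-sided interleaving of `u` (even places) and `v` (odd places), continued by `w`. -/
def interleave {α : Type*} (u v w : ℕ → α) : ℤ → α
  | Int.ofNat k => if k % 2 = 0 then u (k / 2) else v (k / 2)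
  | Int.negSucc k => w k

theorem interleave_even {α : Type*} (u v w : ℕ → α) (i : ℕ) :
    interleave u v w ((2 * i : ℕ) : ℤ) = u i := by
  change (if 2 * i % 2 = 0 then u (2 * i / 2) else v (2 * i / 2)) = u i
  simp

theorem interleave_odd {α : Type*} (u v w : ℕ → α) (i : ℕ) :
    interleave u v w ((2 * i + 1 : ℕ) : ℤ) = v i := by
  change (if (2 * i + 1) % 2 = 0 then u ((2 * i + 1) / 2) else v ((2 * i + 1) / 2)) = v i
  rw [if_neg (by omega)]
  congr 1; omega

theorem csum_interleave (u : ℕ → ℕ) (M : ℕ) (w c : ℕ → ℕ) (hc0 : c 0 = 0)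
    (hc : ∀ i, c (i + 1) = c i + u i + M) (i : ℕ) :
    csum (interleave u (fun _ => M) w) ((2 * i : ℕ) : ℤ) = c i := by
  rw [csum, if_pos (Int.natCast_nonneg _), Int.toNat_natCast]
  induction i with
  | zero => simp [hc0]
  | succ i ih =>
    rw [show 2 * (i + 1) = 2 * i + 1 + 1 by ring, Finset.sum_range_succ, Finset.sum_range_succ, ih,
      interleave_even, interleave_odd, hc]
    push_cast; ring

/-- Mixing and exponential shadowing glue any sequence of orbit segments with a fixed gap. -/
theorem exists_glue (f : X ≃ₜ X) (hmix : TopMixingOn (⇑f) univ) {lam : ℝ}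
    (hsh : ExpShadowingWith f.toEquiv lam) {τ : ℝ} (hτ : 0 < τ) :
    ∃ M : ℕ, ∀ n c : ℕ → ℕ, (∀ i, 1 ≤ n i) → c 0 = 0 → (∀ i, c (i + 1) = c i + n i + M) →
      ∀ x : ℕ → X, ∃ z, ∀ i, ∀ j < n i, dist (f^[c i + j] z) (f^[j] (x i)) <
        τ * Real.exp (-lam * ((min j (n i - j) : ℕ) : ℝ)) := by
  obtain ⟨δ, hδ, hsh⟩ := hsh τ hτ
  obtain ⟨M, hM, hgap⟩ := exists_uniform_gap hmix hδ
  refine ⟨M, fun n c hn hc0 hc x => ?_⟩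
  choose g hg1 hg2 using fun i => hgap (f^[n i] (x i)) (x (i + 1))
  set xs : ℤ → X := interleave x g (fun k => f.symm^[k + 1] (x 0)) with hxs
  set ns : ℤ → ℕ := interleave n (fun _ => M) (fun _ => 1) with hns
  have hps : IsPseudoOrbit (⇑f.toEquiv) δ xs ns := by
    constructor
    · rintro (k | k)
      · rcases Nat.even_or_odd' k with ⟨i, rfl | rfl⟩
        · exact (hn i).trans_eq (interleave_even n (fun _ => M) (fun _ => 1) i).symm
        · exact hM.trans_eq (interleave_odd n (fun _ => M) (fun _ => 1) i).symm
      · exact le_rfl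
    · rintro (k | k)
      · rcases Nat.even_or_odd' k with ⟨i, rfl | rfl⟩
        · have e1 : xs (Int.ofNat (2 * i)) = x i := interleave_even _ _ _ i
          have e2 : ns (Int.ofNat (2 * i)) = n i := interleave_even _ _ _ i
          have e3 : xs (Int.ofNat (2 * i) + 1) = g i := interleave_odd x g _ i
          rw [e1, e2, e3]
          exact hg1 i
        · have e1 : xs (Int.ofNat (2 * i + 1)) = g i := interleave_odd x g _ i
          have e2 : ns (Int.ofNat (2 * i + 1)) = M := interleave_odd n (fun _ => M) _ i
          have e3 : xs (Int.ofNat (2 * i + 1) + 1) = x (i + 1) := interleave_even x g _ (i + 1)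
          rw [e1, e2, e3]
          exact hg2 i
      · have e2 : ns (Int.negSucc k) = 1 := rfl
        have e1 : xs (Int.negSucc k) = f.symm^[k + 1] (x 0) := rfl
        have e3 : xs (Int.negSucc k + 1) = f.symm^[k] (x 0) := by
          cases k with
          | zero => exact interleave_even x g _ 0
          | succ k => rfl
        rw [e1, e2, e3, Function.iterate_succ_apply' f.symm]
        change dist (f (f.symm (f.symm^[k] (x 0)))) _ < δ
        rwa [f.apply_symm_apply, dist_self]
  obtain ⟨z, hz⟩ := hsh xs ns hps
  refine ⟨z, fun i j hj => ?_⟩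
  have e2 : ns ((2 * i : ℕ) : ℤ) = n i := interleave_even _ _ _ i
  have e1 : xs ((2 * i : ℕ) : ℤ) = x i := interleave_even _ _ _ i
  have h := hz ((2 * i : ℕ) : ℤ) j (e2.symm ▸ hj)
  rw [e1, e2, csum_interleave n M _ c hc0 hc i, ← Nat.cast_add, zpow_natCast,
    ← Equiv.Perm.iterate_eq_pow] at h
  exact h

end Gluing

section SeparatedSets

universe u

variable {X : Type u} [MetricSpace X] {f : X → X}

theorem isOpen_dynBall (hf : Continuous f) (x : X) (n : ℕ) (r : ℝ) : IsOpen (dynBall f x n r) := by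
  have : dynBall f x n r = ⋂ i ∈ Finset.range n, {y | dist (f^[i] x) (f^[i] y) < r} := by
    ext y; simp [dynBall]
  rw [this]
  exact isOpen_biInter_finset fun i _ =>
    isOpen_lt (continuous_const.dist (hf.iterate i)) continuous_const

theorem exists_card_le_of_isDynSep [CompactSpace X] (hf : Continuous f) (n : ℕ) {ε : ℝ}
    (hε : 0 < ε) :
    ∃ K : ℕ, ∀ (E : Set X) (S : Finset X), IsDynSep f E n ε S → S.card ≤ K := by
  obtain ⟨t, ht⟩ := isCompact_univ.elim_finite_subcover
    (fun x => dynBall f x n (ε / 2)) (fun x => isOpen_dynBall hf x n _)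
    (fun x _ => mem_iUnion.2 ⟨x, fun i _ => by rw [dist_self]; positivity⟩)
  refine ⟨t.card, fun E S hS => ?_⟩
  have hex : ∀ y : X, ∃ x ∈ t, y ∈ dynBall f x n (ε / 2) := fun y => by
    simpa using ht (mem_univ y)
  choose g hgt hg using hex
  refine Finset.card_le_card_of_injOn g (fun y _ => hgt y) fun y hy y' hy' hyy => ?_
  by_contra hne
  obtain ⟨i, hi, hd⟩ := hS.2 y hy y' hy' hne
  have h1 := hg y i hi
  have h2 := hg y' i hi
  rw [← hyy] at h2
  have := dist_triangle_left (f^[i] y) (f^[i] y') (f^[i] (g y))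
  linarith

theorem card_le_sepCount [CompactSpace X] (hf : Continuous f) {E : Set X} {n : ℕ} {ε : ℝ}
    (hε : 0 < ε) {S : Finset X} (hS : IsDynSep f E n ε S) : S.card ≤ sepCount f E n ε := by
  obtain ⟨K, hK⟩ := exists_card_le_of_isDynSep hf n hε
  refine le_csSup ⟨K, ?_⟩ ⟨S, hS, rfl⟩
  rintro _ ⟨S, hS, rfl⟩
  exact hK E S hS

/-- A maximal separated subset spans. -/
theorem exists_maximal_isDynSep [CompactSpace X] (hf : Continuous f) (G : Set X) (n : ℕ) {ε : ℝ}
    (hε : 0 < ε) : ∃ S : Finset X, IsDynSep f G n ε S ∧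
      ∀ y ∈ G, ∃ x ∈ S, ∀ i < n, dist (f^[i] x) (f^[i] y) ≤ ε := by
  classical
  obtain ⟨K, hK⟩ := exists_card_le_of_isDynSep hf n hε
  have hne : {k | ∃ S : Finset X, IsDynSep f G n ε ↑S ∧ S.card = k}.Nonempty :=
    ⟨0, ∅, ⟨by simp, by simp⟩, rfl⟩
  have hbdd : BddAbove {k | ∃ S : Finset X, IsDynSep f G n ε ↑S ∧ S.card = k} := by
    refine ⟨K, ?_⟩
    rintro _ ⟨S, hS, rfl⟩
    exact hK G S hS
  obtain ⟨S, hS, hcard⟩ := Nat.sSup_mem hne hbdd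
  refine ⟨S, hS, fun y hy => ?_⟩
  by_contra! hcon
  have hyS : y ∉ S := fun h => by
    obtain ⟨i, -, hi⟩ := hcon y h
    rw [dist_self] at hi
    exact hε.not_gt hi
  have hS' : IsDynSep f G n ε ↑(insert y S) := by
    refine ⟨by simpa [insert_subset_iff] using ⟨hy, hS.1⟩, fun a ha b hb hab => ?_⟩
    simp only [Finset.coe_insert, mem_insert_iff, Finset.mem_coe] at ha hb
    rcases ha with rfl | ha <;> rcases hb with rfl | hb
    · exact absurd rfl hab
    · obtain ⟨i, hi, h⟩ := hcon b hb
      exact ⟨i, hi, by rwa [dist_comm]⟩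
    · exact hcon a ha
    · exact hS.2 a ha b hb hab
  have := le_csSup hbdd ⟨_, hS', rfl⟩
  rw [Finset.card_insert_of_notMem hyS, hcard] at this
  omega

/-- A finite set is `(s, c)`-spread up to order `n` at scale `ρ` if covering it by Bowen balls of
orders at most `n` costs at least `c`, a ball of order `u` having weight `e^{-su}`. -/
def IsSpread (f : X → X) (S : Finset X) (n : ℕ) (ρ s c : ℝ) : Prop :=
  ∀ (ι : Type u) (F : Finset ι) (y : ι → X) (v : ι → ℕ), (∀ i ∈ F, v i ≤ n) →
    (S : Set X) ⊆ ⋃ i ∈ F, dynBall f (y i) (v i) ρ → c ≤ ∑ i ∈ F, Real.exp (-s * v i)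

theorem IsSpread.le_card {S : Finset X} {n : ℕ} {ρ s c : ℝ} (h : IsSpread f S n ρ s c)
    (hρ : 0 < ρ) : c ≤ S.card * Real.exp (-s * n) := by
  have := h X S id (fun _ => n) (fun _ _ => le_rfl) fun x hx =>
    mem_iUnion₂.2 ⟨x, hx, fun i _ => by rw [id, dist_self]; exact hρ⟩
  simpa using this

/-- Separated sets inside sets of large measure are spread with any rate below the entropy. -/
theorem exists_isSpread [CompactSpace X] [MeasurableSpace X] [BorelSpace X] (hf : Continuous f)
    (μ : Measure X) [IsProbabilityMeasure μ] (hμ : MeasurePreserving f μ μ) {s : ℝ}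
    (hs : (s : EReal) < ksEnt f μ) :
    ∃ ρ₀ > 0, ∃ δ > 0, ∃ c > 0, ∀ ρ > 0, ρ ≤ ρ₀ → ∀ G, MeasurableSet G → μ.real Gᶜ ≤ δ →
      ∀ n : ℕ, ∃ S : Finset X, ↑S ⊆ G ∧ IsDynSep f univ n ρ S ∧ IsSpread f S n ρ s c := by
  obtain ⟨ε, hε, δ, hδ, c, hc, h⟩ := exists_le_sum_of_cover.{u, u} hμ hs
  refine ⟨ε / 2, by positivity, δ, hδ, c, hc, fun ρ hρ hρε G hG hGμ n => ?_⟩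
  obtain ⟨S, hS, hmax⟩ := exists_maximal_isDynSep hf G n hρ
  refine ⟨S, hS.1, ⟨subset_univ _, hS.2⟩, fun ι F y v hv hcov => ?_⟩
  refine h G hG hGμ F y v fun g hg => ?_
  obtain ⟨x, hx, hxg⟩ := hmax g hg
  obtain ⟨i, hi, hxi⟩ := mem_iUnion₂.1 (hcov hx)
  refine mem_iUnion₂.2 ⟨i, hi, fun j hj => ?_⟩
  have h1 := hxi j hj
  have h2 := hxg j (hj.trans_le (hv i hi))
  have := dist_triangle (f^[j] (y i)) (f^[j] x) (f^[j] g)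
  linarith

end SeparatedSets

section Schemes

universe u

/-- Data for concatenating orbit segments: during the `i`-th phase, of length `n i` and starting
at time `c i`, points of `Sh i x` follow the orbit of `x`, where `x` is taken from the separated
set `S i`; consecutive phases are separated by gaps of length `M`. -/
structure IsPhaseScheme {X : Type u} [MetricSpace X] (f : X → X) (ρ : ℝ) (M : ℕ)
    (n c : ℕ → ℕ) (S : ℕ → Finset X) (Sh : ℕ → X → Set X) : Prop where
  pos : 0 < ρ
  length_pos : ∀ i, 1 ≤ n i
  start_zero : c 0 = 0
  start_succ : ∀ i, c (i + 1) = c i + n i + M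
  sep : ∀ i, IsDynSep f univ (n i) ρ (S i)
  nonempty : ∀ i, (S i).Nonempty
  close : ∀ i x z, z ∈ Sh i x → ∀ j < n i, dist (f^[c i + j] z) (f^[j] x) ≤ ρ / 8
  realize : ∀ x : ℕ → X, ∃ z, ∀ i, z ∈ Sh i (x i)
  closed : ∀ i x, IsClosed (Sh i x)

variable {X : Type u}

/-- The points following in every phase some element of the corresponding separated set. -/
def phaseSet (S : ℕ → Finset X) (Sh : ℕ → X → Set X) : Set X :=
  {z | ∀ i, ∃ x ∈ S i, z ∈ Sh i x}

/-- The points of the phase set that follow the branch `x` during the first `k` phases. -/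
def branchSet (S : ℕ → Finset X) (Sh : ℕ → X → Set X) (x : ℕ → X) (k : ℕ) : Set X :=
  {z | ∃ y : ℕ → X, (∀ i, y i ∈ S i) ∧ (∀ i < k, y i = x i) ∧ ∀ i, z ∈ Sh i (y i)}

variable {S : ℕ → Finset X} {Sh : ℕ → X → Set X}

theorem mem_phaseSet_of_branch {y : ℕ → X} (hy : ∀ i, y i ∈ S i) {z : X}
    (hz : ∀ i, z ∈ Sh i (y i)) : z ∈ phaseSet S Sh := fun i => ⟨y i, hy i, hz i⟩

theorem branchSet_subset {x x' : ℕ → X} {k k' : ℕ} (hk : k ≤ k') (h : ∀ i < k, x' i = x i) :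
    branchSet S Sh x' k' ⊆ branchSet S Sh x k := by
  rintro z ⟨y, hy, hyx, hz⟩
  exact ⟨y, hy, fun i hi => (hyx i (hi.trans_le hk)).trans (h i hi), hz⟩

theorem mem_shadow_of_mem_branchSet {x : ℕ → X} {k i : ℕ} (hi : i < k) {z : X}
    (hz : z ∈ branchSet S Sh x k) : z ∈ Sh i (x i) := by
  obtain ⟨y, -, hyx, hz⟩ := hz
  exact hyx i hi ▸ hz i

/-- Passing to the limit along a sequence of longer and longer branches. -/
theorem exists_limit_branch (R : ℕ → (ℕ → X) → ℕ → Prop)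
    (h0 : ∃ x, (∀ i, x i ∈ S i) ∧ R 0 x 0)
    (hstep : ∀ j x k, (∀ i, x i ∈ S i) → R j x k →
      ∃ x' k', (∀ i, x' i ∈ S i) ∧ k < k' ∧ (∀ i < k, x' i = x i) ∧ R (j + 1) x' k') :
    ∃ y : ℕ → X, (∀ i, y i ∈ S i) ∧
      ∀ j, ∃ x k, j ≤ k ∧ R j x k ∧ ∀ i < k, y i = x i := by
  obtain ⟨x₀, hx₀, hR₀⟩ := h0
  let T := ℕ → {p : (ℕ → X) × ℕ // ∀ i, p.1 i ∈ S i}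
  have hstep' : ∀ j (p : {p : (ℕ → X) × ℕ // ∀ i, p.1 i ∈ S i}),
      ∃ q : {p : (ℕ → X) × ℕ // ∀ i, p.1 i ∈ S i}, R j p.1.1 p.1.2 →
        p.1.2 < q.1.2 ∧ (∀ i < p.1.2, q.1.1 i = p.1.1 i) ∧ R (j + 1) q.1.1 q.1.2 := by
    rintro j ⟨⟨x, k⟩, hx⟩
    by_cases hR : R j x k
    · obtain ⟨x', k', hx', h⟩ := hstep j x k hx hR
      exact ⟨⟨⟨x', k'⟩, hx'⟩, fun _ => h⟩
    · exact ⟨⟨⟨x, k⟩, hx⟩, fun h => absurd h hR⟩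
  choose nxt hnxt using hstep'
  let st : T := fun j => Nat.rec ⟨⟨x₀, 0⟩, hx₀⟩ (fun j p => nxt j p) j
  have hR : ∀ j, R j (st j).1.1 (st j).1.2 := by
    intro j
    induction j with
    | zero => exact hR₀
    | succ j ih => exact (hnxt j (st j) ih).2.2
  have hlt : ∀ j, (st j).1.2 < (st (j + 1)).1.2 := fun j => (hnxt j (st j) (hR j)).1
  have hag : ∀ j, ∀ i < (st j).1.2, (st (j + 1)).1.1 i = (st j).1.1 i := fun j =>
    (hnxt j (st j) (hR j)).2.1
  have hmono : StrictMono fun j => (st j).1.2 := strictMono_nat_of_lt_succ hlt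
  have hag' : ∀ j j', j ≤ j' → ∀ i < (st j).1.2, (st j').1.1 i = (st j).1.1 i := by
    intro j j' hjj i hi
    induction j', hjj using Nat.le_induction with
    | base => rfl
    | succ j' hjj ih => rw [hag j' i (hi.trans_le (hmono.monotone hjj)), ih]
  refine ⟨fun i => (st (i + 1)).1.1 i, fun i => (st (i + 1)).2 i, fun j =>
    ⟨(st j).1.1, (st j).1.2, hmono.le_apply, hR j, fun i hi => ?_⟩⟩
  rcases le_total j (i + 1) with h | h
  · exact hag' _ _ h i hi
  · exact (hag' _ _ h i ((Nat.lt_succ_self i).trans_le (hmono.le_apply (x := i + 1)))).symm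

namespace IsPhaseScheme

variable [MetricSpace X] {f : X → X} {ρ : ℝ} {M : ℕ} {n c : ℕ → ℕ}

theorem exists_branch (hS : IsPhaseScheme f ρ M n c S Sh) : ∃ x : ℕ → X, ∀ i, x i ∈ S i :=
  ⟨fun i => (hS.nonempty i).choose, fun i => (hS.nonempty i).choose_spec⟩

theorem isCompact_phaseSet [CompactSpace X] (hS : IsPhaseScheme f ρ M n c S Sh) :
    IsCompact (phaseSet S Sh) := by
  have : phaseSet S Sh = ⋂ i, ⋃ x ∈ S i, Sh i x := by
    ext z; simp [phaseSet]
  rw [this]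
  exact (isClosed_iInter fun i => isClosed_biUnion_finset fun x _ => hS.closed i x).isCompact

theorem exists_dist_gt (hS : IsPhaseScheme f ρ M n c S Sh) {i : ℕ} {x x' z z' : X}
    (hx : x ∈ S i) (hx' : x' ∈ S i) (hne : x ≠ x') (hz : z ∈ Sh i x) (hz' : z' ∈ Sh i x') :
    ∃ j < n i, 3 * ρ / 4 < dist (f^[c i + j] z) (f^[c i + j] z') := by
  obtain ⟨j, hj, hd⟩ := (hS.sep i).2 x hx x' hx' hne
  refine ⟨j, hj, ?_⟩
  have h1 := hS.close i x z hz j hj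
  have h2 := hS.close i x' z' hz' j hj
  have h3 := dist_triangle4 (f^[j] x) (f^[c i + j] z) (f^[c i + j] z') (f^[j] x')
  rw [dist_comm (f^[j] x) (f^[c i + j] z)] at h3
  linarith

theorem le_start (hS : IsPhaseScheme f ρ M n c S Sh) (i : ℕ) : i ≤ c i := by
  induction i with
  | zero => exact Nat.zero_le _
  | succ i ih =>
    have := hS.length_pos i
    rw [hS.start_succ]; omega

theorem card_le_sepCount [CompactSpace X] (hf : Continuous f)
    (hS : IsPhaseScheme f ρ M n c S Sh) (i : ℕ) :
    (S i).card ≤ sepCount f (phaseSet S Sh) (c i + n i) (ρ / 2) := by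
  classical
  obtain ⟨x₀, hx₀⟩ := hS.exists_branch
  choose z hz using fun v : X => hS.realize (Function.update x₀ i v)
  have hzi : ∀ v, z v ∈ Sh i v := fun v => by simpa using hz v i
  have hzE : ∀ v ∈ S i, z v ∈ phaseSet S Sh := fun v hv =>
    mem_phaseSet_of_branch (fun j => by
      rcases eq_or_ne j i with rfl | hj
      · simpa using hv
      · simpa [Function.update_of_ne hj] using hx₀ j) (hz v)
  have hρ := hS.pos
  have hinj : Set.InjOn z (S i) := fun v hv w hw hvw => by
    by_contra hne
    obtain ⟨j, -, hd⟩ := hS.exists_dist_gt hv hw hne (hzi v) (hzi w)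
    rw [hvw, dist_self] at hd
    linarith
  rw [← Finset.card_image_of_injOn hinj]
  refine _root_.card_le_sepCount hf (by positivity) ⟨?_, ?_⟩
  · intro y hy
    obtain ⟨v, hv, rfl⟩ := Finset.mem_image.1 hy
    exact hzE v hv
  · intro y hy y' hy' hne
    obtain ⟨v, hv, rfl⟩ := Finset.mem_image.1 hy
    obtain ⟨w, hw, rfl⟩ := Finset.mem_image.1 hy'
    obtain ⟨j, hj, hd⟩ := hS.exists_dist_gt hv hw (fun h => hne (by rw [h])) (hzi v) (hzi w)
    exact ⟨c i + j, by omega, by linarith⟩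

theorem frequently_order (hS : IsPhaseScheme f ρ M n c S Sh) {P : ℕ → Prop}
    (h : ∃ᶠ i in atTop, P (c i + n i)) : ∃ᶠ N in atTop, P N := by
  have : Tendsto (fun i => c i + n i) atTop atTop :=
    tendsto_atTop_mono (fun i => (hS.le_start i).trans (Nat.le_add_right _ _)) tendsto_id
  exact this.frequently h

theorem le_topEnt [CompactSpace X] (hf : Continuous f) (hS : IsPhaseScheme f ρ M n c S Sh)
    {Y : Set X} (hY : phaseSet S Sh ⊆ Y) {s : ℝ}
    (hs : ∃ᶠ i in atTop, Real.exp (s * (c i + n i : ℕ)) ≤ (S i).card) :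
    (s : EReal) ≤ topEnt f Y := by
  have hρ := hS.pos
  refine le_trans ?_ (le_iSup₂_of_le (phaseSet S Sh) hS.isCompact_phaseSet
    (le_iSup_of_le hY le_rfl))
  refine le_iSup₂_of_le (ρ / 2) (by positivity) ?_
  refine le_limsup_of_frequently_le ?_
  have h1 : ∃ᶠ N : ℕ in atTop, Real.exp (s * N) ≤ sepCount f (phaseSet S Sh) N (ρ / 2) :=
    hS.frequently_order (P := fun N => Real.exp (s * N) ≤ sepCount f (phaseSet S Sh) N (ρ / 2))
      (hs.mono fun i hi => hi.trans (by exact_mod_cast hS.card_le_sepCount hf i))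
  refine (h1.and_eventually (eventually_gt_atTop 0)).mono fun N ⟨hN, hN0⟩ => ?_
  rw [EReal.coe_le_coe_iff, le_div_iff₀ (by exact_mod_cast hN0)]
  exact (Real.le_log_iff_exp_le ((Real.exp_pos _).trans_le hN)).2 hN

theorem le_packEnt (hS : IsPhaseScheme f ρ M n c S Sh) {Y : Set X} (hY : phaseSet S Sh ⊆ Y)
    {s : ℝ} (hs : ∃ᶠ i in atTop, Real.exp (s * (c i + n i : ℕ)) ≤ (S i).card) :
    (s : EReal) ≤ packEnt f Y := by
  classical
  have hρ := hS.pos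
  refine le_iSup₂_of_le (ρ / 4) (by positivity) (le_sInf ?_)
  rintro _ ⟨t, rfl, ht⟩
  rw [EReal.coe_le_coe_iff]
  by_contra! hts
  have h1 : packMeas f t (ρ / 4) Y < 1 := by rw [ht]; exact one_pos
  simp only [packMeas, iInf_lt_iff] at h1
  obtain ⟨C, hYC, hC⟩ := h1
  have hN : ∀ i, ∃ N, packPre f t N (ρ / 4) (C i) < 1 := fun i =>
    iInf_lt_iff.1 ((ENNReal.le_tsum i).trans_lt hC)
  choose N hN using hN
  obtain ⟨y, hy, hyR⟩ := exists_limit_branch (S := S)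
    (fun j x k => ∀ i, j = i + 1 → Disjoint (branchSet S Sh x k) (C i))
    (by
      obtain ⟨x, hx⟩ := hS.exists_branch
      exact ⟨x, hx, fun i hi => absurd hi (by omega)⟩)
    (by
      intro j x k hx _
      obtain ⟨i, ⟨hik, hiN⟩, hi⟩ := ((eventually_ge_atTop k).and
        (eventually_ge_atTop (N j))).and_frequently hs |>.exists
      by_contra! hcon
      have hmeet : ∀ v ∈ S i, ∃ z ∈ C j, z ∈ Sh i v := by
        intro v hv
        have hx' : ∀ l, Function.update x i v l ∈ S l := fun l => by
          rcases eq_or_ne l i with rfl | hl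
          · simpa using hv
          · simpa [Function.update_of_ne hl] using hx l
        obtain ⟨j', hj', hd⟩ := hcon (Function.update x i v) (i + 1) hx' (by omega)
          (fun l hl => Function.update_of_ne (by omega) _ _)
        obtain rfl : j = j' := by omega
        obtain ⟨z, hz, hzC⟩ := Set.not_disjoint_iff.1 hd
        exact ⟨z, hzC, by simpa using mem_shadow_of_mem_branchSet (Nat.lt_succ_self i) hz⟩
      choose! z hzC hzS using hmeet
      set T := c i + n i with hT
      have hinj : Set.InjOn (fun v => (z v, T)) (S i) := fun v hv w hw hvw => by
        by_contra hne
        obtain ⟨l, -, hd⟩ := hS.exists_dist_gt hv hw hne (hzS v hv) (hzS w hw)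
        rw [(Prod.mk.inj hvw).1, dist_self] at hd
        linarith
      set D : Finset (X × ℕ) := (S i).image fun v => (z v, T) with hD
      have hle : ∑' p : (D : Set (X × ℕ)), ENNReal.ofReal (Real.exp (-t * ((p : X × ℕ).2 : ℝ))) ≤
          packPre f t (N j) (ρ / 4) (C j) := by
        unfold packPre
        refine le_iSup₂_of_le (D : Set (X × ℕ)) D.countable_toSet
          (le_iSup₂_of_le ?_ ?_ le_rfl)
        · intro p hp
          obtain ⟨v, hv, rfl⟩ := Finset.mem_image.1 hp
          exact ⟨hzC v hv, hiN.trans ((hS.le_start i).trans (Nat.le_add_right _ _))⟩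
        · intro p hp q hq hpq
          obtain ⟨v, hv, rfl⟩ := Finset.mem_image.1 hp
          obtain ⟨w, hw, rfl⟩ := Finset.mem_image.1 hq
          obtain ⟨l, hl, hd⟩ := hS.exists_dist_gt hv hw (fun h => hpq (by rw [h]))
            (hzS v hv) (hzS w hw)
          rw [Set.disjoint_left]
          intro a ha ha'
          have h1 := ha (c i + l) (by omega)
          have h2 := ha' (c i + l) (by omega)
          have h3 := dist_triangle_right (f^[c i + l] (z v)) (f^[c i + l] (z w)) (f^[c i + l] a)
          simp only at h1 h2
          linarith
      refine absurd (hle.trans_lt (hN j)) (not_lt.2 ?_)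
      rw [Finset.tsum_subtype' D (fun p => ENNReal.ofReal (Real.exp (-t * (p.2 : ℝ)))), hD,
        Finset.sum_image hinj]
      simp only [Finset.sum_const, nsmul_eq_mul]
      rw [← ENNReal.ofReal_natCast, ← ENNReal.ofReal_mul (Nat.cast_nonneg _), ENNReal.one_le_ofReal]
      calc (1 : ℝ) ≤ Real.exp ((s - t) * T) :=
            Real.one_le_exp (mul_nonneg (by linarith) (Nat.cast_nonneg _))
        _ = Real.exp (s * T) * Real.exp (-t * T) := by rw [← Real.exp_add]; congr 1; ring
        _ ≤ _ := by gcongr)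
  obtain ⟨z, hz⟩ := hS.realize y
  obtain ⟨j, hj⟩ := mem_iUnion.1 (hYC (hY (mem_phaseSet_of_branch hy hz)))
  obtain ⟨x, k, -, hR, hag⟩ := hyR (j + 1)
  exact Set.disjoint_left.1 (hR j rfl) ⟨y, hy, hag, hz⟩ hj

end IsPhaseScheme

end Schemes

section BowenLowerBound

universe u

variable {X : Type u} [MetricSpace X] {f : X → X} {ρ : ℝ} {M : ℕ} {n c : ℕ → ℕ}
  {S : ℕ → Finset X} {Sh : ℕ → X → Set X}

/-- The balls of the family `B` of order larger than `c k` that meet a branch set of level `k`. -/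
def liveBalls (f : X → X) (ρ : ℝ) (c : ℕ → ℕ) (S : ℕ → Finset X) (Sh : ℕ → X → Set X)
    (B : Set (X × ℕ)) (x : ℕ → X) (k : ℕ) : Set (X × ℕ) :=
  {p | p ∈ B ∧ c k < p.2 ∧ ∃ z ∈ dynBall f p.1 p.2 (ρ / 4), z ∈ branchSet S Sh x k}

/-- The weight of a Bowen ball relative to the starting time of the `k`-th phase. -/
noncomputable def relWeight (t : ℝ) (c : ℕ → ℕ) (k : ℕ) (p : X × ℕ) : ℝ≥0∞ :=
  ENNReal.ofReal (Real.exp (-t * ((p.2 : ℝ) - c k)))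

/-- No ball of `B` of order at most `c k` meets the branch set, and those of larger order that do
have small relative weight. -/
def IsEscaping (f : X → X) (ρ : ℝ) (c : ℕ → ℕ) (S : ℕ → Finset X) (Sh : ℕ → X → Set X)
    (B : Set (X × ℕ)) (t a : ℝ) (x : ℕ → X) (k : ℕ) : Prop :=
  (∀ p ∈ B, p.2 ≤ c k → ∀ z ∈ dynBall f p.1 p.2 (ρ / 4), z ∉ branchSet S Sh x k) ∧
    ∑' p, (liveBalls f ρ c S Sh B x k).indicator (relWeight t c k) p < ENNReal.ofReal a

namespace IsPhaseScheme

/-- The number of one-step extensions of a branch whose live balls are heavy. -/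
theorem card_heavy_le (hS : IsPhaseScheme f ρ M n c S Sh) {B : Set (X × ℕ)} {t a : ℝ}
    (ha : 0 < a) {x : ℕ → X} {k : ℕ}
    (hx : ∑' p, (liveBalls f ρ c S Sh B x k).indicator (relWeight t c k) p ≤ ENNReal.ofReal a)
    {V : Finset X} (hV : V ⊆ S k)
    (hheavy : ∀ v ∈ V, ENNReal.ofReal a ≤ ∑' p,
      (liveBalls f ρ c S Sh B (Function.update x k v) (k + 1)).indicator
        (relWeight t c (k + 1)) p) :
    (V.card : ℝ) ≤ Real.exp (t * (n k + M)) := by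
  classical
  have hρ := hS.pos
  have hshadow : ∀ v z, z ∈ branchSet S Sh (Function.update x k v) (k + 1) → z ∈ Sh k v :=
    fun v z hz => by simpa using mem_shadow_of_mem_branchSet (Nat.lt_succ_self k) hz
  have hpt : ∀ p : X × ℕ, ∑ v ∈ V,
      (liveBalls f ρ c S Sh B (Function.update x k v) (k + 1)).indicator
        (relWeight t c (k + 1)) p ≤
      ENNReal.ofReal (Real.exp (t * (n k + M))) *
        (liveBalls f ρ c S Sh B x k).indicator (relWeight t c k) p := by
    intro p
    by_cases hp : ∃ v ∈ V, p ∈ liveBalls f ρ c S Sh B (Function.update x k v) (k + 1)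
    · obtain ⟨v, hv, hpv⟩ := hp
      rw [Finset.sum_eq_single v, indicator_of_mem hpv, indicator_of_mem]
      · rw [relWeight, relWeight, ← ENNReal.ofReal_mul (Real.exp_pos _).le, ← Real.exp_add]
        refine ENNReal.ofReal_le_ofReal (Real.exp_le_exp.2 (le_of_eq ?_))
        rw [hS.start_succ]; push_cast; ring
      · obtain ⟨hpB, hpc, z, hz, hzb⟩ := hpv
        refine ⟨hpB, ?_, z, hz, branchSet_subset (Nat.le_succ k)
          (fun i hi => Function.update_of_ne hi.ne _ _) hzb⟩
        have := hS.start_succ k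
        omega
      · intro w hw hwv
        refine indicator_of_notMem (fun hpw => ?_) _
        obtain ⟨-, hpc, z, hz, hzb⟩ := hpv
        obtain ⟨-, -, z', hz', hzb'⟩ := hpw
        obtain ⟨j, hj, hd⟩ := hS.exists_dist_gt (hV hv) (hV hw) hwv.symm (hshadow _ _ hzb)
          (hshadow _ _ hzb')
        have hlt : c k + j < p.2 := by have := hS.start_succ k; omega
        have h1 := hz _ hlt
        have h2 := hz' _ hlt
        have h3 := dist_triangle_left (f^[c k + j] z) (f^[c k + j] z') (f^[c k + j] p.1)
        linarith
      · exact fun h => absurd hv h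
    · push Not at hp
      rw [Finset.sum_eq_zero fun v hv => indicator_of_notMem (hp v hv) _]
      exact zero_le
  have h1 : (V.card : ℝ≥0∞) * ENNReal.ofReal a ≤
      ENNReal.ofReal (Real.exp (t * (n k + M))) * ENNReal.ofReal a := by
    calc (V.card : ℝ≥0∞) * ENNReal.ofReal a = ∑ v ∈ V, ENNReal.ofReal a := by simp
      _ ≤ ∑ v ∈ V, ∑' p, (liveBalls f ρ c S Sh B (Function.update x k v) (k + 1)).indicator
            (relWeight t c (k + 1)) p := Finset.sum_le_sum hheavy
      _ = ∑' p, ∑ v ∈ V, (liveBalls f ρ c S Sh B (Function.update x k v) (k + 1)).indicator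
            (relWeight t c (k + 1)) p :=
          (Summable.tsum_finsetSum fun _ _ => ENNReal.summable).symm
      _ ≤ ∑' p, ENNReal.ofReal (Real.exp (t * (n k + M))) *
            (liveBalls f ρ c S Sh B x k).indicator (relWeight t c k) p :=
          ENNReal.tsum_le_tsum hpt
      _ = ENNReal.ofReal (Real.exp (t * (n k + M))) *
            ∑' p, (liveBalls f ρ c S Sh B x k).indicator (relWeight t c k) p :=
          ENNReal.tsum_mul_left
      _ ≤ _ := by gcongr
  rw [← ENNReal.ofReal_natCast, ← ENNReal.ofReal_mul (Nat.cast_nonneg _),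
    ← ENNReal.ofReal_mul (Real.exp_pos _).le, ENNReal.ofReal_le_ofReal_iff (by positivity)] at h1
  exact le_of_mul_le_mul_right h1 ha

/-- An escaping branch has an escaping one-step extension. -/
theorem exists_isEscaping_succ (hS : IsPhaseScheme f ρ M n c S Sh) {B : Set (X × ℕ)}
    {t r R c₀ : ℝ} {x : ℕ → X} {k : ℕ} (hc₀ : 0 < c₀)
    (hspread : IsSpread f (S k) (n k) ρ r c₀) (htr : t ≤ r) (hrR : |r| ≤ R)
    (hlarge : Real.exp (t * (n k + M) - r * n k) ≤ c₀ / 2)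
    (hx : IsEscaping f ρ c S Sh B t (c₀ / (2 * Real.exp (R * M))) x k) :
    ∃ v ∈ S k, IsEscaping f ρ c S Sh B t (c₀ / (2 * Real.exp (R * M)))
      (Function.update x k v) (k + 1) := by
  classical
  set a := c₀ / (2 * Real.exp (R * M)) with ha
  have ha0 : 0 < a := by positivity
  have hρ := hS.pos
  by_contra! hcon
  set V₁ := (S k).filter fun v => ∃ p ∈ B, p.2 ≤ c (k + 1) ∧
    ∃ z ∈ dynBall f p.1 p.2 (ρ / 4), z ∈ branchSet S Sh (Function.update x k v) (k + 1) with hV₁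
  set V₂ := (S k).filter fun v => ENNReal.ofReal a ≤ ∑' p,
      (liveBalls f ρ c S Sh B (Function.update x k v) (k + 1)).indicator
        (relWeight t c (k + 1)) p with hV₂
  have hV : ∀ v ∈ S k, v ∈ V₁ ∨ v ∈ V₂ := by
    intro v hv
    have := hcon v hv
    rw [IsEscaping, not_and_or] at this
    rcases this with h | h
    · push Not at h
      exact Or.inl (Finset.mem_filter.2 ⟨hv, h⟩)
    · exact Or.inr (Finset.mem_filter.2 ⟨hv, not_lt.1 h⟩)
  have hp : ∀ v ∈ V₁, ∃ p ∈ B, p.2 ≤ c (k + 1) ∧ ∃ z ∈ dynBall f p.1 p.2 (ρ / 4),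
      z ∈ branchSet S Sh (Function.update x k v) (k + 1) := fun v hv => (Finset.mem_filter.1 hv).2
  choose! p hpB hpc z hz hzb using hp
  have hzx : ∀ v ∈ V₁, z v ∈ branchSet S Sh x k := fun v hv => branchSet_subset (Nat.le_succ k)
    (fun i hi => Function.update_of_ne hi.ne _ _) (hzb v hv)
  have hlive : ∀ v ∈ V₁, p v ∈ liveBalls f ρ c S Sh B x k := fun v hv =>
    ⟨hpB v hv, not_le.1 fun h => hx.1 _ (hpB v hv) h _ (hz v hv) (hzx v hv),
      z v, hz v hv, hzx v hv⟩
  -- the cover of `S k` by shifted balls and by balls around heavy points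
  have hcov := hspread ((X × ℕ) ⊕ X) ((V₁.image p).disjSum V₂)
    (Sum.elim (fun q => f^[c k] q.1) id)
    (Sum.elim (fun q => min (q.2 - c k) (n k)) fun _ => n k)
    (by rintro (q | v) _ <;> simp)
    (by
      intro v hv
      rcases hV v hv with h | h
      · refine mem_iUnion₂.2 ⟨Sum.inl (p v),
          Finset.inl_mem_disjSum.2 (Finset.mem_image_of_mem p h), fun j hj => ?_⟩
        simp only [Sum.elim_inl, lt_min_iff] at hj ⊢
        have h1 : z v ∈ Sh k v := by
          simpa using mem_shadow_of_mem_branchSet (Nat.lt_succ_self k) (hzb v h)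
        have h2 := hS.close k v _ h1 j hj.2
        have h3 := hz v h (c k + j) (by omega)
        have h4 := dist_triangle (f^[c k + j] (p v).1) (f^[c k + j] (z v)) (f^[j] v)
        rw [← Function.iterate_add_apply, add_comm j]
        linarith
      · refine mem_iUnion₂.2 ⟨Sum.inr v, Finset.inr_mem_disjSum.2 h, fun j _ => ?_⟩
        simpa using hρ)
  rw [Finset.sum_disjSum] at hcov
  simp only [Sum.elim_inl, Sum.elim_inr, Finset.sum_const, nsmul_eq_mul] at hcov
  -- light part
  have hsum : ∑ q ∈ V₁.image p, Real.exp (-t * ((q.2 : ℝ) - c k)) < a := by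
    rw [← ENNReal.ofReal_lt_ofReal_iff ha0, ENNReal.ofReal_sum_of_nonneg
      fun _ _ => (Real.exp_pos _).le]
    refine lt_of_le_of_lt ?_ hx.2
    refine le_trans (Finset.sum_le_sum fun q hq => ?_) (ENNReal.sum_le_tsum (V₁.image p))
    obtain ⟨v, hv, rfl⟩ := Finset.mem_image.1 hq
    rw [indicator_of_mem (hlive v hv), relWeight]
  have hlight : ∑ q ∈ V₁.image p, Real.exp (-r * (min (q.2 - c k) (n k) : ℕ)) ≤
      Real.exp (R * M) * ∑ q ∈ V₁.image p, Real.exp (-t * ((q.2 : ℝ) - c k)) := by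
    rw [Finset.mul_sum]
    refine Finset.sum_le_sum fun q hq => ?_
    obtain ⟨v, hv, rfl⟩ := Finset.mem_image.1 hq
    rw [← Real.exp_add, Real.exp_le_exp]
    have h1 := (hlive v hv).2.1
    have h2 := hpc v hv
    rw [hS.start_succ] at h2
    obtain ⟨d, hd⟩ : ∃ d, (p v).2 = c k + d := ⟨(p v).2 - c k, by omega⟩
    rw [hd, Nat.add_sub_cancel_left]
    obtain ⟨e, he, heM⟩ : ∃ e, d = min d (n k) + e ∧ e ≤ M := ⟨d - min d (n k), by omega, by omega⟩
    have hd' : (d : ℝ) = ((min d (n k) : ℕ) : ℝ) + e := by exact_mod_cast he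
    have h3 : r * e ≤ R * M := by
      calc r * e ≤ |r| * e := by gcongr; exact le_abs_self r
        _ ≤ R * M := by gcongr; exact (abs_nonneg _).trans hrR
    have h4 : t * d ≤ r * d := by gcongr
    rw [Nat.cast_add, add_sub_cancel_left]
    have h5 := congrArg (r * ·) hd'
    simp only [mul_add] at h5
    linarith
  have hV₂card : (V₂.card : ℝ) * Real.exp (-r * n k) ≤ c₀ / 2 := by
    have := hS.card_heavy_le ha0 hx.2.le (Finset.filter_subset _ _)
      (fun v hv => (Finset.mem_filter.1 hv).2) (V := V₂)
    refine le_trans ?_ hlarge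
    calc (V₂.card : ℝ) * Real.exp (-r * n k) ≤
        Real.exp (t * (n k + M)) * Real.exp (-r * n k) := by gcongr
      _ = _ := by rw [← Real.exp_add]; congr 1; ring
  have hfin : Real.exp (R * M) * ∑ q ∈ V₁.image p, Real.exp (-t * ((q.2 : ℝ) - c k)) <
      c₀ / 2 := by
    have : Real.exp (R * M) * a = c₀ / 2 := by rw [ha]; field_simp
    rw [← this]
    gcongr
  linarith

theorem le_bowenEnt (hS : IsPhaseScheme f ρ M n c S Sh) {Y : Set X} (hY : phaseSet S Sh ⊆ Y)
    {s R c₀ : ℝ} {r : ℕ → ℝ} (hc₀ : 0 < c₀) (hspread : ∀ k, IsSpread f (S k) (n k) ρ (r k) c₀)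
    (hsr : ∀ k, s ≤ r k) (hrR : ∀ k, |r k| ≤ R)
    (hlarge : ∀ k, Real.exp (s * (n k + M) - r k * n k) ≤ c₀ / 2) :
    (s : EReal) ≤ bowenEnt f Y := by
  classical
  have hρ := hS.pos
  refine le_iSup₂_of_le (ρ / 4) (by positivity) (le_sInf ?_)
  rintro _ ⟨t, rfl, ht⟩
  rw [EReal.coe_le_coe_iff]
  by_contra! hts
  set a := c₀ / (2 * Real.exp (R * M)) with ha
  have ha0 : 0 < a := by positivity
  have h1 : bowenCn f Y t (ρ / 4) 1 < ENNReal.ofReal a := by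
    refine lt_of_le_of_lt (le_iSup (bowenCn f Y t (ρ / 4)) 1) ?_
    change bowenC f Y t (ρ / 4) < _
    rw [ht]
    exact ENNReal.ofReal_pos.2 ha0
  simp only [bowenCn, iInf_lt_iff] at h1
  obtain ⟨B, -, hB1, hYB, hB⟩ := h1
  obtain ⟨y, hy, hyR⟩ := exists_limit_branch (S := S)
    (fun _ x k => IsEscaping f ρ c S Sh B t a x k)
    (by
      obtain ⟨x, hx⟩ := hS.exists_branch
      refine ⟨x, hx, fun p hp hp0 => ?_, lt_of_le_of_lt ?_ hB⟩
      · have := hB1 p hp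
        rw [hS.start_zero] at hp0
        omega
      · rw [bowenSum, tsum_subtype B fun p => ENNReal.ofReal (Real.exp (-t * (p.2 : ℝ)))]
        refine ENNReal.tsum_le_tsum fun p => ?_
        by_cases hp : p ∈ liveBalls f ρ c S Sh B x 0
        · rw [indicator_of_mem hp, indicator_of_mem hp.1, relWeight, hS.start_zero]
          simp
        · rw [indicator_of_notMem hp]
          exact zero_le)
    (by
      intro j x k hx hR
      have htk : t * (n k + M) ≤ s * (n k + M) := by gcongr
      obtain ⟨v, hv, hesc⟩ := hS.exists_isEscaping_succ hc₀ (hspread k) (hts.le.trans (hsr k))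
        (hrR k) (le_trans (Real.exp_le_exp.2 (by linarith)) (hlarge k)) hR
      refine ⟨Function.update x k v, k + 1, fun i => ?_, Nat.lt_succ_self k,
        fun i hi => Function.update_of_ne hi.ne _ _, hesc⟩
      rcases eq_or_ne i k with rfl | hi
      · simpa using hv
      · simpa [Function.update_of_ne hi] using hx i)
  obtain ⟨z, hz⟩ := hS.realize y
  obtain ⟨p, hp, hzp⟩ := mem_iUnion₂.1 (hYB (hY (mem_phaseSet_of_branch hy hz)))
  obtain ⟨x, k, hk, hR, hag⟩ := hyR p.2
  exact hR.1 p hp (hk.trans (hS.le_start k)) z hzp ⟨y, hy, hag, hz⟩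

end IsPhaseScheme

end BowenLowerBound

section Construction

universe u

theorem eventually_mul_add_le {s t : ℝ} (h : t < s) (K : ℝ) :
    ∀ᶠ n : ℕ in atTop, t * n + K ≤ s * n := by
  have h1 : Tendsto (fun n : ℕ => (s - t) * (n : ℝ)) atTop atTop :=
    tendsto_natCast_atTop_atTop.const_mul_atTop (sub_pos.2 h)
  filter_upwards [h1.eventually_ge_atTop K] with n hn
  linarith

theorem IsSpread.mono {X : Type u} [MetricSpace X] {f : X → X} {S : Finset X} {n : ℕ}
    {ρ s c c' : ℝ} (h : IsSpread f S n ρ s c) (hc : c' ≤ c) : IsSpread f S n ρ s c' :=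
  fun ι F y v hv hcov => hc.trans (h ι F y v hv hcov)

theorem mem_MLIrr_of_frequently {X : Type*} {m : ℕ} {f : X → X} {A : X → (Em m ≃L[ℝ] Em m)}
    {z : X} {χ : Bool → ℝ} {ε : ℝ} (hε : 2 * ε < |χ false - χ true|)
    (h : ∀ b, ∃ᶠ N : ℕ in atTop, |logGrowth f A N z - N * χ b| ≤ ε * N) : z ∈ MLIrr f A := by
  rintro ⟨l, hl⟩
  have hb : ∀ b, |l - χ b| ≤ ε := by
    intro b
    by_contra! hlt
    have h1 : ∀ᶠ N : ℕ in atTop, ε < |Real.log ‖cocycle f A z N‖ / N - χ b| :=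
      ((hl.sub_const (χ b)).abs).eventually_const_lt hlt
    obtain ⟨N, hN, hN1, hN0⟩ := ((h b).and_eventually (h1.and (eventually_gt_atTop 0))).exists
    have hN' : (0 : ℝ) < N := by exact_mod_cast hN0
    have h2 : logGrowth f A N z - N * χ b = N * (Real.log ‖cocycle f A z N‖ / N - χ b) := by
      rw [logGrowth]
      field_simp
    rw [h2, abs_mul, abs_of_pos hN', mul_comm] at hN
    exact absurd (le_of_mul_le_mul_right hN hN') (not_le.2 hN1)
  have h1 := abs_sub_le (χ false) l (χ true)
  have h2 := hb false
  have h3 := hb true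
  rw [abs_sub_comm] at h2
  linarith

theorem frequently_bodd_eq (b : Bool) : ∃ᶠ i : ℕ in atTop, i.bodd = b := by
  refine frequently_atTop.2 fun k => ?_
  cases b
  · exact ⟨2 * k, by omega, by simp⟩
  · exact ⟨2 * k + 1, by omega, by simp⟩

/-- Concatenating alternately segments typical for two measures with distinct exponents yields a
phase scheme made of irregular points. -/
theorem exists_irregular_scheme {X : Type u} [MetricSpace X] [CompactSpace X] [MeasurableSpace X]
    [BorelSpace X] {m : ℕ} [NeZero m] (f : X ≃ₜ X) (hmix : TopMixingOn (⇑f) univ)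
    (hshadow : ExpShadowing f.toEquiv) {A : X → (Em m ≃L[ℝ] Em m)} (hA : HolderMat A)
    (ν : Bool → Measure X) [∀ b, IsProbabilityMeasure (ν b)] (he : ∀ b, Ergodic f (ν b))
    (hne : mle f A (ν false) ≠ mle f A (ν true)) {s t : Bool → ℝ} (hts : ∀ b, t b < s b)
    (hs : ∀ b, (s b : EReal) < ksEnt f (ν b)) :
    ∃ (ρ : ℝ) (M : ℕ) (n c : ℕ → ℕ) (S : ℕ → Finset X) (Sh : ℕ → X → Set X) (c₀ : ℝ),
      0 < c₀ ∧ IsPhaseScheme f ρ M n c S Sh ∧ phaseSet S Sh ⊆ MLIrr f A ∧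
      ∀ i, Real.exp (t i.bodd * (c i + n i : ℕ)) ≤ (S i).card ∧
        IsSpread f (S i) (n i) ρ (s i.bodd) c₀ ∧
        Real.exp (t i.bodd * (n i + M) - s i.bodd * n i) ≤ c₀ / 2 := by
  obtain ⟨lam, hlam, hsh⟩ := hshadow
  have hf : Continuous f := f.continuous
  set ε := |mle f A (ν false) - mle f A (ν true)| / 4 with hεdef
  have hε : 0 < ε := div_pos (abs_pos.2 (sub_ne_zero.2 hne)) (by norm_num)
  choose ρ₀ hρ₀ δ hδ c₁ hc₁ hspread using fun b =>
    exists_isSpread hf (ν b) (he b).toMeasurePreserving (hs b)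
  choose τ₀ hτ₀ G hGm hGδ hG using fun b => exists_phase hf hA (ν b) (he b) hlam hε (hδ b)
  obtain ⟨ρ, hρ, hρle⟩ : ∃ ρ > 0, ∀ b, ρ ≤ ρ₀ b :=
    ⟨min (ρ₀ false) (ρ₀ true), lt_min (hρ₀ _) (hρ₀ _), by rintro (_ | _) <;> simp⟩
  obtain ⟨c₀, hc₀, hc₀le⟩ : ∃ c₀ > 0, ∀ b, c₀ ≤ c₁ b :=
    ⟨min (c₁ false) (c₁ true), lt_min (hc₁ _) (hc₁ _), by rintro (_ | _) <;> simp⟩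
  obtain ⟨τ, hτ, hτle, hτρ⟩ : ∃ τ > 0, (∀ b, τ ≤ τ₀ b) ∧ τ ≤ ρ / 8 :=
    ⟨min (min (τ₀ false) (τ₀ true)) (ρ / 8),
      lt_min (lt_min (hτ₀ _) (hτ₀ _)) (by positivity), by rintro (_ | _) <;> simp, by simp⟩
  obtain ⟨M, hglue⟩ := exists_glue f hmix hsh hτ
  have hlen : ∀ b (k : ℕ), ∃ N : ℕ, 1 ≤ N ∧ (ν b).real (G b N)ᶜ ≤ δ b ∧
      (∀ x ∈ G b N, ∀ z, (∀ j < N, dist (f^[k + j] z) (f^[j] x) ≤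
          τ₀ b * Real.exp (-lam * ((min j (N - j) : ℕ) : ℝ))) →
        |logGrowth f A (k + N) z - (k + N : ℕ) * mle f A (ν b)| ≤ ε * (k + N : ℕ)) ∧
      t b * N + (t b * k - Real.log c₀) ≤ s b * N ∧
      t b * N + (t b * M - Real.log (c₀ / 2)) ≤ s b * N := fun b k =>
    ((eventually_ge_atTop 1).and ((hGδ b).and ((hG b k).and
      ((eventually_mul_add_le (hts b) _).and (eventually_mul_add_le (hts b) _))))).exists
  choose N hN1 hNδ hNG hNk hNM using hlen
  set c : ℕ → ℕ := fun i => Nat.rec 0 (fun i k => k + N i.bodd k + M) i with hc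
  set n : ℕ → ℕ := fun i => N i.bodd (c i) with hn
  have hcs : ∀ i, c (i + 1) = c i + n i + M := fun i => rfl
  choose S hSG hSsep hSspread using fun i : ℕ =>
    hspread i.bodd ρ hρ (hρle _) (G i.bodd (n i)) (hGm _ _) (hNδ _ _) (n i)
  have hcard : ∀ i, Real.exp (t i.bodd * (c i + n i : ℕ)) ≤ (S i).card := by
    intro i
    have h1 := ((hSspread i).mono (hc₀le _)).le_card hρ
    have h2 : t i.bodd * n i + (t i.bodd * c i - Real.log c₀) ≤ s i.bodd * n i := hNk _ _
    calc Real.exp (t i.bodd * (c i + n i : ℕ))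
        ≤ Real.exp (Real.log c₀ + s i.bodd * n i) := by
          rw [Real.exp_le_exp]
          push_cast
          linarith
      _ = c₀ * Real.exp (s i.bodd * n i) := by rw [Real.exp_add, Real.exp_log hc₀]
      _ ≤ ((S i).card * Real.exp (-s i.bodd * n i)) * Real.exp (s i.bodd * n i) := by gcongr
      _ = (S i).card := by rw [mul_assoc, ← Real.exp_add]; simp
  set Sh : ℕ → X → Set X := fun i x => {z | ∀ j < n i, dist (f^[c i + j] z) (f^[j] x) ≤
    τ * Real.exp (-lam * ((min j (n i - j) : ℕ) : ℝ))} with hSh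
  refine ⟨ρ, M, n, c, S, Sh, c₀, hc₀, ⟨hρ, fun i => hN1 _ _, rfl, hcs, hSsep, fun i => ?_,
    fun i x z hz j hj => ?_, fun x => ?_, fun i x => ?_⟩, fun z hz => ?_, fun i =>
      ⟨hcard i, (hSspread i).mono (hc₀le _), ?_⟩⟩
  · rw [← Finset.card_pos]
    exact_mod_cast (Real.exp_pos _).trans_le (hcard i)
  · refine (hz j hj).trans (le_trans ?_ hτρ)
    refine mul_le_of_le_one_right hτ.le (Real.exp_le_one_iff.2 ?_)
    rw [neg_mul]
    exact neg_nonpos.2 (by positivity)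
  · obtain ⟨z, hz⟩ := hglue n c (fun i => hN1 _ _) rfl hcs x
    exact ⟨z, fun i j hj => (hz i j hj).le⟩
  · simp only [hSh, ofPred_forall]
    exact isClosed_iInter fun j => isClosed_iInter fun _ =>
      isClosed_le ((hf.iterate _).dist continuous_const) continuous_const
  · refine mem_MLIrr_of_frequently (χ := fun b => mle f A (ν b)) (ε := ε) (by linarith)
      fun b => ?_
    have hgrow : Tendsto (fun i => c i + n i) atTop atTop := by
      refine tendsto_atTop_mono (f := id) (fun i => ?_) tendsto_id
      have : ∀ i, i ≤ c i := by
        intro i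
        induction i with
        | zero => exact Nat.zero_le _
        | succ i ih =>
          have h1 : 1 ≤ n i := hN1 _ _
          rw [hcs]
          omega
      exact (this i).trans (Nat.le_add_right _ _)
    refine hgrow.frequently ((frequently_bodd_eq b).mono ?_)
    rintro i rfl
    obtain ⟨x, hx, hzx⟩ := hz i
    refine hNG _ _ x (hSG i hx) z fun j hj => (hzx j hj).trans ?_
    gcongr
    exact hτle _
  · have h2 : t i.bodd * n i + (t i.bodd * M - Real.log (c₀ / 2)) ≤ s i.bodd * n i := hNM _ _
    rw [← Real.le_log_iff_exp_le (by positivity)]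
    linarith

theorem ksEnt_nonneg {X : Type*} [MeasurableSpace X] (f : X → X) (μ : Measure X)
    [IsProbabilityMeasure μ] : 0 ≤ ksEnt f μ := by
  refine le_iSup_of_le 1 (le_iSup₂_of_le (fun _ => 0) measurable_const ?_)
  exact_mod_cast Real.iInf_nonneg fun n => div_nonneg (partHn_nonneg _) (by positivity)

theorem mle_eq_zero_of_dim_zero {X : Type*} [MeasurableSpace X] (f : X → X)
    (A : X → (Em 0 ≃L[ℝ] Em 0)) (μ : Measure X) : mle f A μ = 0 := by
  have h : ∀ x n, cocycle f A x n = 0 := fun x n => Subsingleton.elim _ _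
  simp [mle, h]

theorem le_of_forall_real_lt {a b : EReal} (h : ∀ t : ℝ, (t : EReal) < a → (t : EReal) ≤ b) :
    a ≤ b := by
  by_contra! hlt
  obtain ⟨t, ht1, ht2⟩ := EReal.lt_iff_exists_real_btwn.1 hlt
  exact absurd (h t ht2) (not_le.2 ht1)

theorem ksEnt_le_topEnt_packEnt_MLIrr {X : Type u} [MetricSpace X] [CompactSpace X]
    [MeasurableSpace X] [BorelSpace X] {m : ℕ}
    [NeZero m] (f : X ≃ₜ X) (hmix : TopMixingOn (⇑f) univ) (hshadow : ExpShadowing f.toEquiv)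
    {A : X → (Em m ≃L[ℝ] Em m)} (hA : HolderMat A) (ν : Bool → Measure X)
    [∀ b, IsProbabilityMeasure (ν b)] (he : ∀ b, Ergodic f (ν b))
    (hne : mle f A (ν false) ≠ mle f A (ν true)) (b : Bool) :
    ksEnt f (ν b) ≤ min (topEnt f (MLIrr f A)) (packEnt f (MLIrr f A)) := by
  refine le_of_forall_real_lt fun t ht => ?_
  obtain ⟨s, hts, hs⟩ := EReal.lt_iff_exists_real_btwn.1 ht
  have hneg : ∀ b, ((-1 : ℝ) : EReal) < ksEnt f (ν b) := fun b =>
    lt_of_lt_of_le (by exact_mod_cast neg_one_lt_zero) (ksEnt_nonneg f (ν b))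
  obtain ⟨ρ, M, n, c, S, Sh, c₀, -, hS, hirr, hi⟩ := exists_irregular_scheme f hmix hshadow hA ν he
    hne (s := fun b' => if b' = b then s else -1) (t := fun b' => if b' = b then t else -2)
    (fun b' => by
      split_ifs
      · exact_mod_cast hts
      · norm_num)
    (fun b' => by
      split_ifs with h
      · exact h ▸ hs
      · exact hneg b')
  have hfreq : ∃ᶠ i in atTop, Real.exp (t * (c i + n i : ℕ)) ≤ (S i).card :=
    (frequently_bodd_eq b).mono fun i hib => by simpa [hib] using (hi i).1
  exact le_min (hS.le_topEnt f.continuous hirr hfreq) (hS.le_packEnt hirr hfreq)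

theorem min_ksEnt_le_bowenEnt_MLIrr {X : Type u} [MetricSpace X] [CompactSpace X]
    [MeasurableSpace X] [BorelSpace X] {m : ℕ}
    [NeZero m] (f : X ≃ₜ X) (hmix : TopMixingOn (⇑f) univ) (hshadow : ExpShadowing f.toEquiv)
    {A : X → (Em m ≃L[ℝ] Em m)} (hA : HolderMat A) (ν : Bool → Measure X)
    [∀ b, IsProbabilityMeasure (ν b)] (he : ∀ b, Ergodic f (ν b))
    (hne : mle f A (ν false) ≠ mle f A (ν true)) :
    min (ksEnt f (ν false)) (ksEnt f (ν true)) ≤ bowenEnt f (MLIrr f A) := by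
  refine le_of_forall_real_lt fun t ht => ?_
  obtain ⟨s, hts, hs⟩ := EReal.lt_iff_exists_real_btwn.1 ht
  rw [lt_min_iff] at hs
  have hts' : t < s := by exact_mod_cast hts
  obtain ⟨ρ, M, n, c, S, Sh, c₀, hc₀, hS, hirr, hi⟩ := exists_irregular_scheme f hmix hshadow hA ν
    he hne (s := fun _ => s) (t := fun _ => t) (fun _ => hts')
    (Bool.forall_bool.2 hs)
  exact hS.le_bowenEnt hirr hc₀ (fun k => (hi k).2.1) (fun _ => hts'.le) (fun _ => le_rfl)
    fun k => (hi k).2.2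

end Construction

/-- **Proposition 3.3.** Let `f` be a topologically mixing homeomorphism of a compact metric
space with the exponential shadowing property and `A : X → GL(m,ℝ)` a Hölder continuous matrix
function. If `μ₁, μ₂` are ergodic invariant measures with `χ_max(A,μ₁) > χ_max(A,μ₂)`, and
`h* = min{h_{μ₁}(f), h_{μ₂}(f)}`, `H* = max{h_{μ₁}(f), h_{μ₂}(f)}`, then
`min{h_top(f, MLI(A,f)), h^P_top(f, MLI(A,f))} ≥ H*` and `h^B_top(f, MLI(A,f)) ≥ h*`. -/
theorem entropy_estimates_from_two_measures
    {X : Type*} [MetricSpace X] [CompactSpace X] [MeasurableSpace X] [BorelSpace X] {m : ℕ}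
    (f : X ≃ₜ X) (hmix : TopMixingOn (⇑f) univ) (hshadow : ExpShadowing f.toEquiv)
    (A : X → (Em m ≃L[ℝ] Em m)) (hA : HolderMat A)
    (μ₁ μ₂ : Measure X) (hp₁ : IsProbabilityMeasure μ₁) (hp₂ : IsProbabilityMeasure μ₂)
    (he₁ : Ergodic (⇑f) μ₁) (he₂ : Ergodic (⇑f) μ₂)
    (hlt : mle (⇑f) A μ₂ < mle (⇑f) A μ₁) :
    max (ksEnt (⇑f) μ₁) (ksEnt (⇑f) μ₂)
        ≤ min (topEnt (⇑f) (MLIrr (⇑f) A)) (packEnt (⇑f) (MLIrr (⇑f) A)) ∧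
      min (ksEnt (⇑f) μ₁) (ksEnt (⇑f) μ₂) ≤ bowenEnt (⇑f) (MLIrr (⇑f) A) := by
  rcases m.eq_zero_or_pos with rfl | hm
  · simp [mle_eq_zero_of_dim_zero] at hlt
  have : NeZero m := ⟨hm.ne'⟩
  let ν : Bool → Measure X := fun b => cond b μ₁ μ₂
  have : ∀ b, IsProbabilityMeasure (ν b) := Bool.forall_bool.2 ⟨hp₂, hp₁⟩
  have he : ∀ b, Ergodic f (ν b) := Bool.forall_bool.2 ⟨he₂, he₁⟩
  have hle := ksEnt_le_topEnt_packEnt_MLIrr f hmix hshadow hA ν he hlt.ne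
  refine ⟨max_le (hle true) (hle false), ?_⟩
  rw [min_comm]
  exact min_ksEnt_le_bowenEnt_MLIrr f hmix hshadow hA ν he hlt.ne
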